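/- arXiv:1402.3384 — 6 statements merged into one kernel-verified Lean document; each statement's English description precedes it below -/
import Mathlib

section
/- Under the mechanism E, the companion estimator q̂^u_φ is unbiased: for every database x ∈ D^n, E_{Y∼E(x)}[q̂^u_φ(Y)] = q_φ(x). -/
open Finset

abbrev Row (l : ℕ) := Fin l → Bool
abbrev Db (l n : ℕ) := Fin n → Row l

/-- Hamming distance on `D^n`. -/
def ham {l n : ℕ} (x y : Db l n) : ℕ :=
  (Finset.univ.filter fun i => x i ≠ y i).card

/-- The pmf of the mechanism `E` on input `x`. -/
noncomputable def pE (l : ℕ) (ε : ℝ) {n : ℕ} (x y : Db l n) : ℝ :=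
  Real.exp (-ε * (ham x y : ℝ)) / (1 + ((2:ℝ) ^ l - 1) * Real.exp (-ε)) ^ n

/-- `a_i = min_{v ∈ D} φ_i(v)`. -/
noncomputable def Amin {l n : ℕ} (φ : Fin n → Row l → ℝ) (i : Fin n) : ℝ :=
  Finset.univ.inf' Finset.univ_nonempty (φ i)

/-- `b_i = max_{v ∈ D} φ_i(v)`. -/
noncomputable def Bmax {l n : ℕ} (φ : Fin n → Row l → ℝ) (i : Fin n) : ℝ :=
  Finset.univ.sup' Finset.univ_nonempty (φ i)

/-- The statistical query `q_φ(x) = (∑ i φ_i(x_i)) / (∑ i c_i)` with `c_i = b_i - a_i`. -/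
noncomputable def qS {l n : ℕ} (φ : Fin n → Row l → ℝ) (x : Db l n) : ℝ :=
  (∑ i, φ i (x i)) / (∑ i, (Bmax φ i - Amin φ i))

/-- `C_φ = (∑ i ∑ v φ_i(v)) / (∑ i c_i)`. -/
noncomputable def Cphi {l n : ℕ} (φ : Fin n → Row l → ℝ) : ℝ :=
  (∑ i, ∑ v : Row l, φ i v) / (∑ i, (Bmax φ i - Amin φ i))

/-- The unbiased companion estimator
`q̂ᵘ_φ(y) = (g(ε)/(1-e^{-ε})) q_φ(y) - (e^{-ε}/(1-e^{-ε})) C_φ` where `g(ε)=1+(2^l-1)e^{-ε}`. -/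
noncomputable def qhatu {l n : ℕ} (ε : ℝ) (φ : Fin n → Row l → ℝ) (y : Db l n) : ℝ :=
  ((1 + ((2:ℝ) ^ l - 1) * Real.exp (-ε)) / (1 - Real.exp (-ε))) * qS φ y
    - (Real.exp (-ε) / (1 - Real.exp (-ε))) * Cphi φ

/-- The expectation of a function of one coordinate under a finite product distribution. -/
theorem sum_prod_mul_apply {ι α : Type*} [Fintype ι] [DecidableEq ι] [Fintype α]
    (w : ι → α → ℝ) (hw : ∀ i, ∑ v, w i v = 1) (i : ι) (f : α → ℝ) :
    ∑ y : ι → α, (∏ j, w j (y j)) * f (y i) = ∑ v, w i v * f v := by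
  have hy (y : ι → α) : (∏ j, w j (y j)) * f (y i)
      = ∏ j, w j (y j) * (if j = i then f (y j) else 1) := by
    rw [Finset.prod_mul_distrib, Finset.prod_ite_eq' univ i fun j => f (y j),
      if_pos (mem_univ i)]
  simp_rw [hy]
  rw [← Fintype.prod_sum fun j v => w j v * (if j = i then f v else 1),
    Fintype.prod_eq_single i fun j hj => by simp [hj, hw]]
  simp

/-- Summing a function against the weights `1` at `u` and `t` elsewhere. -/
theorem sum_ite_ne_mul {α : Type*} [Fintype α] [DecidableEq α] (t : ℝ) (u : α) (f : α → ℝ) :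
    ∑ v, (if u ≠ v then t else 1) * f v = (1 - t) * f u + t * ∑ v, f v := by
  have hv (v : α) : (if u ≠ v then t else 1) * f v
      = (if u = v then (1 - t) * f v else 0) + t * f v := by
    by_cases h : u = v
    · simp [h]; ring
    · simp [h]
  simp_rw [hv, Finset.sum_add_distrib, ← Finset.mul_sum]
  simp

/-- The mechanism perturbs the rows independently. -/
theorem pE_eq_prod {l n : ℕ} (ε : ℝ) (x y : Db l n) :
    pE l ε x y = ∏ i, (if x i ≠ y i then Real.exp (-ε) else 1) /
      (1 + ((2:ℝ) ^ l - 1) * Real.exp (-ε)) := by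
  rw [pE, Finset.prod_div_distrib, Finset.prod_ite, ham, mul_comm, Real.exp_nat_mul]
  simp

theorem normalizer_pos (l : ℕ) (ε : ℝ) : 0 < 1 + ((2:ℝ) ^ l - 1) * Real.exp (-ε) := by
  have : (1:ℝ) ≤ 2 ^ l := one_le_pow₀ (by norm_num)
  have := mul_nonneg (sub_nonneg.2 this) (Real.exp_pos (-ε)).le
  linarith

theorem sum_row_weight {l : ℕ} (ε : ℝ) (u : Row l) :
    ∑ v, (if u ≠ v then Real.exp (-ε) else 1) /
      (1 + ((2:ℝ) ^ l - 1) * Real.exp (-ε)) = 1 := by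
  have h := sum_ite_ne_mul (Real.exp (-ε)) u fun _ => 1
  simp only [mul_one] at h
  rw [← Finset.sum_div, div_eq_one_iff_eq (normalizer_pos l ε).ne', h]
  simp
  ring

theorem sum_pE {l n : ℕ} (ε : ℝ) (x : Db l n) : ∑ y, pE l ε x y = 1 := by
  simp_rw [pE_eq_prod]
  rw [← Fintype.prod_sum fun i v => (if x i ≠ v then Real.exp (-ε) else 1) /
    (1 + ((2:ℝ) ^ l - 1) * Real.exp (-ε))]
  exact Finset.prod_eq_one fun i _ => sum_row_weight ε (x i)

/-- The expectation of the plain query under the mechanism. -/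
theorem sum_pE_mul_qS {l n : ℕ} (ε : ℝ) (φ : Fin n → Row l → ℝ) (x : Db l n) :
    ∑ y, pE l ε x y * qS φ y =
      ((1 - Real.exp (-ε)) * qS φ x + Real.exp (-ε) * Cphi φ) /
        (1 + ((2:ℝ) ^ l - 1) * Real.exp (-ε)) := by
  have hrow (i : Fin n) : ∑ y, pE l ε x y * φ i (y i) =
      ((1 - Real.exp (-ε)) * φ i (x i) + Real.exp (-ε) * ∑ v, φ i v) /
        (1 + ((2:ℝ) ^ l - 1) * Real.exp (-ε)) := by
    simp_rw [pE_eq_prod]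
    rw [sum_prod_mul_apply (fun i v => (if x i ≠ v then Real.exp (-ε) else 1) /
      (1 + ((2:ℝ) ^ l - 1) * Real.exp (-ε))) (fun i => sum_row_weight ε (x i)) i (φ i),
      ← sum_ite_ne_mul, Finset.sum_div]
    exact Finset.sum_congr rfl fun v _ => div_mul_eq_mul_div _ _ _
  simp_rw [qS, Cphi, ← mul_div_assoc, ← Finset.sum_div, Finset.mul_sum]
  rw [Finset.sum_comm]
  simp_rw [hrow]
  rw [← Finset.sum_div, Finset.sum_add_distrib]
  simp_rw [Finset.mul_sum]
  ring

/-- Under the mechanism `E`, the companion estimator `q̂ᵘ_φ` is unbiased: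
`E_{Y∼E(x)}[q̂ᵘ_φ(Y)] = q_φ(x)` for every database `x`. -/
theorem stmt3 (l n : ℕ) (hl : 1 ≤ l) (hn : 1 ≤ n) (ε : ℝ) (hε : 0 < ε)
    (φ : Fin n → Row l → ℝ) (a b c : ℝ) (hc : 0 < c)
    (hq : ∀ i, a ≤ Amin φ i ∧ Amin φ i < Bmax φ i ∧ Bmax φ i ≤ b ∧
      c ≤ Bmax φ i - Amin φ i)
    (x : Db l n) :
    (∑ y : Db l n, pE l ε x y * qhatu ε φ y) = qS φ x := by
  have hg := (normalizer_pos l ε).ne'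
  have ht : 1 - Real.exp (-ε) ≠ 0 :=
    (sub_pos.2 (Real.exp_lt_one_iff.2 (neg_lt_zero.2 hε))).ne'
  simp_rw [qhatu, mul_sub, Finset.sum_sub_distrib, mul_left_comm (pE l ε x _),
    ← Finset.mul_sum, sum_pE_mul_qS, ← Finset.sum_mul, sum_pE]
  field_simp
  ring
end

section
/- Under the mechanism E, the squared-error distortion of the companion estimator q̂^u_φ satisfies: for every database x ∈ D^n, E_{Y∼E(x)}[(q̂^u_φ(Y) − q_φ(x))²] ≤ (b−a)²(1+(2^l−1)e^{−ε})² / (c²(1−e^{−ε})²·n). -/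
open Finset

/-- Second moment of a sum of independent centred variables on a finite product space. -/
theorem sum_prod_mul_sum_sq {ι α : Type*} [Fintype ι] [DecidableEq ι] [Fintype α]
    (w f : ι → α → ℝ) (hw : ∀ i, ∑ v, w i v = 1) (hf : ∀ i, ∑ v, w i v * f i v = 0) :
    ∑ y : ι → α, (∏ i, w i (y i)) * (∑ i, f i (y i)) ^ 2 = ∑ i, ∑ v, w i v * f i v ^ 2 := by
  have factor (i j : ι) : ∑ y : ι → α, (∏ k, w k (y k)) * (f i (y i) * f j (y j)) =
      ∏ k, ∑ v, w k v * ((if k = i then f k v else 1) * (if k = j then f k v else 1)) := by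
    rw [Finset.prod_univ_sum, Fintype.piFinset_univ]
    refine Finset.sum_congr rfl fun y _ => ?_
    simp only [Finset.prod_mul_distrib, Finset.prod_ite_eq', Finset.mem_univ, if_true]
  have diag (i j : ι) : ∑ y : ι → α, (∏ k, w k (y k)) * (f i (y i) * f j (y j)) =
      if i = j then ∑ v, w i v * f i v ^ 2 else 0 := by
    rw [factor]
    split_ifs with h
    · subst h
      rw [Finset.prod_eq_single i]
      · simp [sq]
      · intro k _ hk
        simp [hk, hw]
      · simp
    · exact Finset.prod_eq_zero (Finset.mem_univ i) (by simp [h, hf])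
  calc
    _ = ∑ i, ∑ j, ∑ y : ι → α, (∏ k, w k (y k)) * (f i (y i) * f j (y j)) := by
      simp_rw [sq, Finset.sum_mul_sum, Finset.mul_sum]
      rw [Finset.sum_comm]
      exact Finset.sum_congr rfl fun i _ => Finset.sum_comm
    _ = _ := by simp [diag]

/-- The normalising factor `g(ε)` of a single row. -/
noncomputable def rowNorm (l : ℕ) (ε : ℝ) : ℝ := 1 + ((2:ℝ) ^ l - 1) * Real.exp (-ε)

/-- The pmf of the mechanism on a single row. -/
noncomputable def pRow (l : ℕ) (ε : ℝ) (u v : Row l) : ℝ :=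
  (if u ≠ v then Real.exp (-ε) else 1) / rowNorm l ε

theorem rowNorm_pos (l : ℕ) (ε : ℝ) : 0 < rowNorm l ε := by
  have h : (1:ℝ) ≤ 2 ^ l := one_le_pow₀ (by norm_num)
  have := mul_nonneg (sub_nonneg.2 h) (Real.exp_pos (-ε)).le
  unfold rowNorm
  linarith

theorem pRow_nonneg (l : ℕ) (ε : ℝ) (u v : Row l) : 0 ≤ pRow l ε u v := by
  have := rowNorm_pos l ε
  unfold pRow
  split_ifs <;> positivity

theorem pE_eq_prod_pRow (l : ℕ) (ε : ℝ) {n : ℕ} (x y : Db l n) :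
    pE l ε x y = ∏ i, pRow l ε (x i) (y i) := by
  simp only [pRow, Finset.prod_div_distrib, Finset.prod_const, Finset.card_univ, Fintype.card_fin,
    Finset.prod_ite, one_pow, mul_one]
  rw [← Real.exp_nat_mul, mul_comm _ (-ε)]
  rfl

/-- The mean of a function of one row under the mechanism. -/
theorem sum_pRow_mul (l : ℕ) (ε : ℝ) (u : Row l) (h : Row l → ℝ) :
    ∑ v, pRow l ε u v * h v =
      ((1 - Real.exp (-ε)) * h u + Real.exp (-ε) * ∑ v, h v) / rowNorm l ε := by
  have (v : Row l) : pRow l ε u v * h v =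
      ((if u = v then (1 - Real.exp (-ε)) * h v else 0) + Real.exp (-ε) * h v) / rowNorm l ε := by
    unfold pRow
    by_cases huv : u = v <;> simp [huv] <;> ring
  simp_rw [this]
  rw [← Finset.sum_div, Finset.sum_add_distrib, Finset.mul_sum]
  simp

theorem sum_pRow (l : ℕ) (ε : ℝ) (u : Row l) : ∑ v, pRow l ε u v = 1 := by
  have h := sum_pRow_mul l ε u fun _ => 1
  have hg := (rowNorm_pos l ε).ne'
  simp only [mul_one] at h
  rw [h, div_eq_one_iff_eq hg]
  simp [rowNorm]
  ring

/-- A weighted mean of a function with values in `[a, b]` lies within `b - a` of every value. -/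
theorem sq_sub_sum_mul_le {α : Type*} [Fintype α] (w h : α → ℝ) (hw : ∀ v, 0 ≤ w v)
    (hw1 : ∑ v, w v = 1) {a b : ℝ} (ha : ∀ v, a ≤ h v) (hb : ∀ v, h v ≤ b) (u : α) :
    (h u - ∑ v, w v * h v) ^ 2 ≤ (b - a) ^ 2 := by
  have lower : a ≤ ∑ v, w v * h v := by
    calc a = ∑ v, w v * a := by rw [← Finset.sum_mul, hw1, one_mul]
      _ ≤ _ := Finset.sum_le_sum fun v _ => mul_le_mul_of_nonneg_left (ha v) (hw v)
  have upper : ∑ v, w v * h v ≤ b := by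
    calc _ ≤ ∑ v, w v * b := Finset.sum_le_sum fun v _ => mul_le_mul_of_nonneg_left (hb v) (hw v)
      _ = b := by rw [← Finset.sum_mul, hw1, one_mul]
  exact sq_le_sq' (by linarith [ha u]) (by linarith [hb u])

/-- The error of the companion estimator is a rescaled sum of centred row contributions. -/
theorem qhatu_sub_qS {l n : ℕ} {ε : ℝ} (hε : 0 < ε) (φ : Fin n → Row l → ℝ) (x y : Db l n) :
    qhatu ε φ y - qS φ x =
      rowNorm l ε / (1 - Real.exp (-ε)) / (∑ i, (Bmax φ i - Amin φ i)) *
        ∑ i, (φ i (y i) - ∑ v, pRow l ε (x i) v * φ i v) := by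
  have he : 1 - Real.exp (-ε) ≠ 0 := (sub_pos.2 (Real.exp_lt_one_iff.2 (by linarith))).ne'
  have hg := (rowNorm_pos l ε).ne'
  simp only [sum_pRow_mul]
  rw [Finset.sum_sub_distrib (fun i => φ i (y i)), ← Finset.sum_div, Finset.sum_add_distrib, ← Finset.mul_sum,
    ← Finset.mul_sum]
  unfold qhatu qS Cphi
  rw [← rowNorm]
  generalize (∑ i, (Bmax φ i - Amin φ i)) = S
  simp only [div_eq_mul_inv _ S]
  field_simp
  ring

/-- Under the mechanism `E`, the squared-error distortion of `q̂ᵘ_φ` satisfies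
`E_{Y∼E(x)}[(q̂ᵘ_φ(Y) - q_φ(x))²] ≤ (b-a)²(1+(2^l-1)e^{-ε})²/(c²(1-e^{-ε})² n)`. -/
theorem stmt4 (l n : ℕ) (hl : 1 ≤ l) (hn : 1 ≤ n) (ε : ℝ) (hε : 0 < ε)
    (φ : Fin n → Row l → ℝ) (a b c : ℝ) (hc : 0 < c)
    (hq : ∀ i, a ≤ Amin φ i ∧ Amin φ i < Bmax φ i ∧ Bmax φ i ≤ b ∧
      c ≤ Bmax φ i - Amin φ i)
    (x : Db l n) :
    (∑ y : Db l n, pE l ε x y * (qhatu ε φ y - qS φ x) ^ 2)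
      ≤ (b - a) ^ 2 * (1 + ((2:ℝ) ^ l - 1) * Real.exp (-ε)) ^ 2
          / (c ^ 2 * (1 - Real.exp (-ε)) ^ 2 * n) := by
  have he : 0 < 1 - Real.exp (-ε) := sub_pos.2 (Real.exp_lt_one_iff.2 (by linarith))
  have hn' : (0:ℝ) < n := by exact_mod_cast hn
  have hS : n * c ≤ ∑ i, (Bmax φ i - Amin φ i) := by
    calc n * c = ∑ _i : Fin n, c := by simp
      _ ≤ _ := Finset.sum_le_sum fun i _ => (hq i).2.2.2
  have hlow (i : Fin n) (v : Row l) : a ≤ φ i v :=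
    (hq i).1.trans (Finset.inf'_le _ (Finset.mem_univ v))
  have hupp (i : Fin n) (v : Row l) : φ i v ≤ b :=
    (Finset.le_sup' (φ i) (Finset.mem_univ v)).trans (hq i).2.2.1
  set f : Fin n → Row l → ℝ := fun i v => φ i v - ∑ v, pRow l ε (x i) v * φ i v with hfdef
  have hcent (i : Fin n) : ∑ v, pRow l ε (x i) v * f i v = 0 := by
    simp only [hfdef, mul_sub, Finset.sum_sub_distrib]
    rw [← Finset.sum_mul, sum_pRow, one_mul, sub_self]
  have hvar : ∑ i, ∑ v, pRow l ε (x i) v * f i v ^ 2 ≤ n * (b - a) ^ 2 := by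
    calc _ ≤ ∑ _i : Fin n, (b - a) ^ 2 := Finset.sum_le_sum fun i _ => ?_
      _ = _ := by simp
    calc _ ≤ ∑ v, pRow l ε (x i) v * (b - a) ^ 2 :=
          Finset.sum_le_sum fun v _ => mul_le_mul_of_nonneg_left
            (sq_sub_sum_mul_le _ _ (pRow_nonneg l ε (x i)) (sum_pRow l ε (x i)) (hlow i) (hupp i) v)
            (pRow_nonneg l ε (x i) v)
      _ = _ := by rw [← Finset.sum_mul, sum_pRow, one_mul]
  have hsum : ∑ y : Db l n, pE l ε x y * (qhatu ε φ y - qS φ x) ^ 2 =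
      (rowNorm l ε / (1 - Real.exp (-ε)) / (∑ i, (Bmax φ i - Amin φ i))) ^ 2 *
        ∑ i, ∑ v, pRow l ε (x i) v * f i v ^ 2 := by
    rw [← sum_prod_mul_sum_sq _ _ (fun i => sum_pRow l ε (x i)) hcent, Finset.mul_sum]
    refine Finset.sum_congr rfl fun y _ => ?_
    rw [pE_eq_prod_pRow, qhatu_sub_qS hε]
    ring
  rw [hsum, ← rowNorm]
  have hg := rowNorm_pos l ε
  have hSpos : 0 < ∑ i, (Bmax φ i - Amin φ i) := (by positivity : 0 < n * c).trans_le hS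
  have hvar_nonneg : 0 ≤ ∑ i, ∑ v, pRow l ε (x i) v * f i v ^ 2 :=
    Finset.sum_nonneg fun i _ => Finset.sum_nonneg fun v _ =>
      mul_nonneg (pRow_nonneg l ε (x i) v) (sq_nonneg _)
  calc _ ≤ (rowNorm l ε / (1 - Real.exp (-ε)) / (n * c)) ^ 2 * (n * (b - a) ^ 2) := by
        gcongr
    _ = _ := by field_simp
end

section
/- The minimax distortion for statistical queries satisfies the asymptotic lower bound liminf_{n→∞} n·D_{ε,n}^S ≥ (1−Φ(1))² / (2^{l+4}·(1+e^ε/(2^l−1))³). -/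
open Finset

/-- Two databases are neighbors if they differ in exactly one row. -/
def Neighbor {l n : ℕ} (x x' : Db l n) : Prop :=
  (Finset.univ.filter fun i => x i ≠ x' i).card = 1

/-- `φ` specifies a statistical query with parameters `a, b, c`. -/
def StatQ {l n : ℕ} (a b c : ℝ) (φ : Fin n → Row l → ℝ) : Prop :=
  ∀ i, a ≤ Amin φ i ∧ Amin φ i < Bmax φ i ∧ Bmax φ i ≤ b ∧ c ≤ Bmax φ i - Amin φ i

/-- The minimax distortion `D_{ε,n}^S` for statistical queries. -/
noncomputable def minimaxS (l : ℕ) (ε a b c : ℝ) (n : ℕ) : ℝ :=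
  ⨅ M : {p : Db l n → Db l n → ℝ // (∀ x y, 0 ≤ p x y) ∧ (∀ x, ∑ y, p x y = 1) ∧
      ∀ x x', Neighbor x x' → ∀ y, p x y ≤ Real.exp ε * p x' y},
    ⨆ φ : {φ : Fin n → Row l → ℝ // StatQ a b c φ},
      ⨅ q : {q : Db l n → ℝ // ∀ y, ∃ x0, q y = qS φ.1 x0},
        ⨆ x : Db l n, ∑ y, M.1 x y * (q.1 y - qS φ.1 x) ^ 2

/-- `Φ(1)`, the standard Gaussian cdf evaluated at `1`. -/
noncomputable def Φ1 : ℝ := ((ProbabilityTheory.gaussianReal 0 1) (Set.Iic 1)).toReal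

section ProductWeights

variable {ι α : Type*} [Fintype ι] [DecidableEq ι] [Fintype α]

/-- The second moment of a sum of independent centred variables is the sum of the second moments. -/
theorem sum_prod_mul_sq_sum (w h : ι → α → ℝ) (hw : ∀ i, ∑ v, w i v = 1)
    (hh : ∀ i, ∑ v, w i v * h i v = 0) :
    ∑ y : ι → α, (∏ i, w i (y i)) * (∑ i, h i (y i)) ^ 2 = ∑ i, ∑ v, w i v * h i v ^ 2 := by
  have key : ∀ i j, ∑ y : ι → α, (∏ k, w k (y k)) * (h i (y i) * h j (y j)) =
      if i = j then ∑ v, w i v * h i v ^ 2 else 0 := by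
    intro i j
    have e : ∀ y : ι → α, (∏ k, w k (y k)) * (h i (y i) * h j (y j)) =
        ∏ k, w k (y k) * ((if k = i then h k (y k) else 1) * (if k = j then h k (y k) else 1)) := by
      intro y
      rw [Finset.prod_mul_distrib, Finset.prod_mul_distrib, Fintype.prod_ite_eq',
        Fintype.prod_ite_eq']
    rw [Finset.sum_congr rfl fun y _ => e y]
    rw [← Fintype.prod_sum fun k v =>
      w k v * ((if k = i then h k v else 1) * (if k = j then h k v else 1))]
    split_ifs with hij
    · subst hij
      rw [Finset.prod_eq_single i]
      · simp [sq]
      · intro k _ hk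
        simp [hk, hw]
      · simp
    · apply Finset.prod_eq_zero (Finset.mem_univ i)
      simp [hij, hh]
  simp_rw [sq (∑ i, _), Finset.sum_mul_sum, Finset.mul_sum]
  rw [Finset.sum_comm]
  refine Finset.sum_congr rfl fun i _ => ?_
  rw [Finset.sum_comm]
  simp [key]

/-- The real sign `1` or `-1` of a boolean. -/
def boolSign (t : Bool) : ℝ := if t then 1 else -1

theorem boolSign_sq (t : Bool) : boolSign t ^ 2 = 1 := by
  cases t <;> simp [boolSign]

theorem boolSign_not (t : Bool) : boolSign (!t) = -boolSign t := by
  cases t <;> simp [boolSign]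

/-- The average over all signs of a squared signed sum is the sum of squares. -/
theorem sum_sq_sum_boolSign_mul (r : ι → ℝ) :
    ∑ s : ι → Bool, (∑ i, boolSign (s i) * r i) ^ 2 = 2 ^ Fintype.card ι * ∑ i, r i ^ 2 := by
  have h := sum_prod_mul_sq_sum (fun (_ : ι) (_ : Bool) => (1 / 2 : ℝ))
    (fun i t => boolSign t * r i) (fun i => by norm_num) (fun i => by simp [boolSign])
  have e : ∀ i, ∑ t : Bool, (1 / 2 : ℝ) * (boolSign t * r i) ^ 2 = r i ^ 2 := by
    intro i
    simp only [mul_pow, boolSign_sq, Finset.sum_const, Finset.card_univ, Fintype.card_bool]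
    simp
  simp only [e, Finset.prod_const, Finset.card_univ, ← Finset.mul_sum] at h
  rw [← h, ← mul_assoc, ← mul_pow]
  norm_num

/-- Weighted squared deviation is smallest around the weighted mean. -/
theorem sum_mul_sq_sub_mean_le (w A : α → ℝ) (hW : 0 < ∑ x, w x) (z : ℝ) :
    ∑ x, w x * (A x - (∑ x, w x * A x) / ∑ x, w x) ^ 2 ≤ ∑ x, w x * (z - A x) ^ 2 := by
  set W := ∑ x, w x with hWdef
  set μ := (∑ x, w x * A x) / W with hμ
  have hμW : ∑ x, w x * A x = μ * W := by rw [hμ]; field_simp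
  have e : ∑ x, w x * (z - A x) ^ 2 = ∑ x, w x * (A x - μ) ^ 2 + W * (z - μ) ^ 2 := by
    have h1 : ∀ x, w x * (z - A x) ^ 2 = w x * (A x - μ) ^ 2 + w x * (z ^ 2 - μ ^ 2)
        - 2 * (z - μ) * (w x * A x) := fun x => by ring
    simp_rw [h1]
    rw [Finset.sum_sub_distrib, Finset.sum_add_distrib, ← Finset.sum_mul, ← Finset.mul_sum, hμW,
      ← hWdef]
    ring
  rw [e]
  have := mul_nonneg hW.le (sq_nonneg (z - μ))
  linarith

end ProductWeights

section Bounds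

variable {l n : ℕ}

theorem Amin_le (φ : Fin n → Row l → ℝ) (i : Fin n) (v : Row l) : Amin φ i ≤ φ i v :=
  Finset.inf'_le _ (Finset.mem_univ v)

theorem le_Bmax (φ : Fin n → Row l → ℝ) (i : Fin n) (v : Row l) : φ i v ≤ Bmax φ i :=
  Finset.le_sup' _ (Finset.mem_univ v)

theorem abs_qS_sub_qS_le_one (φ : Fin n → Row l → ℝ) (x y : Db l n) : |qS φ x - qS φ y| ≤ 1 := by
  have hs : |∑ i, φ i (x i) - ∑ i, φ i (y i)| ≤ ∑ i, (Bmax φ i - Amin φ i) := by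
    rw [← Finset.sum_sub_distrib]
    refine (Finset.abs_sum_le_sum_abs _ _).trans (Finset.sum_le_sum fun i _ => ?_)
    rw [abs_le]
    constructor <;>
      linarith [Amin_le φ i (x i), le_Bmax φ i (x i), Amin_le φ i (y i), le_Bmax φ i (y i)]
  unfold qS
  rw [← sub_div, abs_div]
  exact div_le_one_of_le₀ (hs.trans (le_abs_self _)) (abs_nonneg _)

/-- The mean squared error of a proper estimator is at most one. -/
theorem sum_mul_sq_sub_qS_le_one {p : Db l n → Db l n → ℝ} (h0 : ∀ x y, 0 ≤ p x y)
    (h1 : ∀ x, ∑ y, p x y = 1) (φ : Fin n → Row l → ℝ) (q : Db l n → ℝ)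
    (hq : ∀ y, ∃ x0, q y = qS φ x0) (x : Db l n) : ∑ y, p x y * (q y - qS φ x) ^ 2 ≤ 1 := by
  rw [← h1 x]
  refine Finset.sum_le_sum fun y _ => mul_le_of_le_one_right (h0 x y) ?_
  obtain ⟨x0, hx0⟩ := hq y
  rw [hx0, sq_le_one_iff_abs_le_one]
  exact abs_qS_sub_qS_le_one φ x0 x

theorem iSup_sum_mul_sq_nonneg {p : Db l n → Db l n → ℝ} (h0 : ∀ x y, 0 ≤ p x y)
    (φ : Fin n → Row l → ℝ) (q : Db l n → ℝ) : 0 ≤ ⨆ x, ∑ y, p x y * (q y - qS φ x) ^ 2 :=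
  Real.iSup_nonneg fun x => Finset.sum_nonneg fun y _ => mul_nonneg (h0 x y) (sq_nonneg _)

/-- The proper minimax risk of a query is at most one. -/
theorem iInf_iSup_le_one {p : Db l n → Db l n → ℝ} (h0 : ∀ x y, 0 ≤ p x y)
    (h1 : ∀ x, ∑ y, p x y = 1) (φ : Fin n → Row l → ℝ) :
    ⨅ q : {q : Db l n → ℝ // ∀ y, ∃ x0, q y = qS φ x0},
      ⨆ x : Db l n, ∑ y, p x y * (q.1 y - qS φ x) ^ 2 ≤ 1 := by
  refine (ciInf_le (f := fun q : {q : Db l n → ℝ // ∀ y, ∃ x0, q y = qS φ x0} =>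
    ⨆ x : Db l n, ∑ y, p x y * (q.1 y - qS φ x) ^ 2) ⟨0, ?_⟩ ⟨qS φ, fun y => ⟨y, rfl⟩⟩).trans
    (ciSup_le fun x => sum_mul_sq_sub_qS_le_one h0 h1 φ _ (fun y => ⟨y, rfl⟩) x)
  rintro _ ⟨q, rfl⟩
  exact iSup_sum_mul_sq_nonneg h0 φ q.1

end Bounds

section SignQuery

variable {l n : ℕ}

/-- The query counting the rows whose bit `k` agrees with the pattern `s`. -/
noncomputable def signQuery (k : Fin l) (s : Fin n → Bool) (i : Fin n) (v : Row l) : ℝ :=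
  (1 + boolSign (s i) * boolSign (v k)) / 2

theorem signQuery_eq (k : Fin l) (s : Fin n → Bool) (i : Fin n) (v : Row l) :
    signQuery k s i v = if s i = v k then 1 else 0 := by
  unfold signQuery boolSign
  cases s i <;> cases v k <;> norm_num

theorem Amin_signQuery (k : Fin l) (s : Fin n → Bool) (i : Fin n) :
    Amin (signQuery k s) i = 0 := by
  refine le_antisymm ((Amin_le _ i fun _ => !s i).trans (by simp [signQuery_eq])) ?_
  refine Finset.le_inf' _ _ fun v _ => ?_
  rw [signQuery_eq]
  split_ifs <;> norm_num

theorem Bmax_signQuery (k : Fin l) (s : Fin n → Bool) (i : Fin n) :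
    Bmax (signQuery k s) i = 1 := by
  refine le_antisymm (Finset.sup'_le _ _ fun v _ => ?_)
    (le_trans (by simp [signQuery_eq]) (le_Bmax _ i fun _ => s i))
  rw [signQuery_eq]
  split_ifs <;> norm_num

theorem statQ_signQuery {a b c : ℝ} (ha : a ≤ 0) (hb : 1 ≤ b) (hc1 : c ≤ 1) (k : Fin l)
    (s : Fin n → Bool) : StatQ a b c (signQuery k s) := by
  intro i
  rw [Amin_signQuery, Bmax_signQuery]
  exact ⟨ha, one_pos, hb, by linarith⟩

theorem qS_signQuery (hn : 0 < n) (k : Fin l) (s : Fin n → Bool) (x : Db l n) :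
    qS (signQuery k s) x = (1 + (∑ i, boolSign (s i) * boolSign (x i k)) / n) / 2 := by
  have hn' : (n : ℝ) ≠ 0 := by positivity
  simp only [qS, Amin_signQuery, Bmax_signQuery, signQuery, ← Finset.sum_div,
    Finset.sum_add_distrib]
  simp
  field_simp

/-- Flip bit `k` of row `i`. -/
def flipBit (k : Fin l) (i : Fin n) (x : Db l n) : Db l n :=
  Function.update x i (Function.update (x i) k (!x i k))

theorem flipBit_apply (k : Fin l) (i : Fin n) (x : Db l n) : flipBit k i x i k = !x i k := by
  simp [flipBit]

theorem flipBit_involutive (k : Fin l) (i : Fin n) :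
    Function.Involutive (flipBit k i : Db l n → Db l n) := by
  intro x
  simp [flipBit]

theorem neighbor_flipBit (k : Fin l) (i : Fin n) (x : Db l n) : Neighbor x (flipBit k i x) := by
  unfold Neighbor
  rw [Finset.card_eq_one]
  refine ⟨i, Finset.ext fun j => ?_⟩
  simp only [Finset.mem_filter, Finset.mem_univ, true_and, Finset.mem_singleton]
  refine ⟨fun h => ?_, ?_⟩
  · by_contra hj
    exact h (by simp [flipBit, hj])
  · rintro rfl h
    have := congrFun h k
    rw [flipBit_apply] at this
    simp at this

/-- A weight whose ratio across neighbors is at most `T` leaves each bit with weighted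
squared deviation at least `1 / T` of the total weight. -/
theorem sum_le_mul_sum_boolSign_sub_sq {T : ℝ} {w : Db l n → ℝ} (hw : ∀ x, 0 ≤ w x)
    (hT : ∀ x x', Neighbor x x' → w x ≤ T * w x') (k : Fin l) (i : Fin n) (μ : ℝ)
    (hT1 : 1 ≤ T) :
    ∑ x, w x ≤ T * ∑ x, w x * (boolSign (x i k) - μ) ^ 2 := by
  have hflip : ∑ x, w (flipBit k i x) * (boolSign (x i k) + μ) ^ 2 =
      ∑ x, w x * (boolSign (x i k) - μ) ^ 2 := by
    rw [← Equiv.sum_comp (flipBit_involutive k i).toPerm (fun x => w x * (boolSign (x i k) - μ) ^ 2)]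
    refine Finset.sum_congr rfl fun x _ => ?_
    rw [Function.Involutive.coe_toPerm, flipBit_apply, boolSign_not]
    ring
  have h : ∑ x, 2 * w x ≤ ∑ x, (T * (w x * (boolSign (x i k) - μ) ^ 2) +
      T * (w (flipBit k i x) * (boolSign (x i k) + μ) ^ 2)) := by
    refine Finset.sum_le_sum fun x _ => ?_
    have h1 := mul_le_mul_of_nonneg_right (hT x _ (neighbor_flipBit k i x))
      (sq_nonneg (boolSign (x i k) + μ))
    have h2 := mul_le_mul_of_nonneg_right (le_mul_of_one_le_left (hw x) hT1)
      (sq_nonneg (boolSign (x i k) - μ))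
    have h3 : w x * (boolSign (x i k) - μ) ^ 2 + w x * (boolSign (x i k) + μ) ^ 2 =
        2 * w x * boolSign (x i k) ^ 2 + 2 * (w x * μ ^ 2) := by ring
    rw [boolSign_sq] at h3
    have h4 := mul_nonneg (hw x) (sq_nonneg μ)
    linarith
  rw [Finset.sum_add_distrib, ← Finset.mul_sum, ← Finset.mul_sum, ← Finset.mul_sum, hflip] at h
  linarith

/-- Averaged over sign patterns, no guesses `z s` of the signed sums can beat the
per-coordinate deviations. -/
theorem two_pow_mul_sum_le {T : ℝ} {w : Db l n → ℝ} (hw : ∀ x, 0 ≤ w x)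
    (hT : ∀ x x', Neighbor x x' → w x ≤ T * w x') (hT1 : 1 ≤ T) (k : Fin l)
    (z : (Fin n → Bool) → ℝ) :
    2 ^ n * n * ∑ x, w x ≤
      T * ∑ s, ∑ x, w x * (z s - ∑ i, boolSign (s i) * boolSign (x i k)) ^ 2 := by
  rcases (Finset.sum_nonneg fun x _ => hw x : 0 ≤ ∑ x, w x).eq_or_lt with hW | hW
  · rw [← hW, mul_zero]
    exact mul_nonneg (by linarith) (Finset.sum_nonneg fun s _ => Finset.sum_nonneg fun x _ =>
      mul_nonneg (hw x) (sq_nonneg _))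
  set μ : Fin n → ℝ := fun i => (∑ x, w x * boolSign (x i k)) / ∑ x, w x with hμ
  have hmean : ∀ s : Fin n → Bool,
      (∑ x, w x * ∑ i, boolSign (s i) * boolSign (x i k)) / ∑ x, w x =
        ∑ i, boolSign (s i) * μ i := by
    intro s
    simp_rw [hμ, ← mul_div_assoc, ← Finset.sum_div, Finset.mul_sum]
    rw [Finset.sum_comm]
    congr 1
    refine Finset.sum_congr rfl fun i _ => Finset.sum_congr rfl fun x _ => by ring
  calc 2 ^ n * n * ∑ x, w x = 2 ^ n * ∑ _i : Fin n, ∑ x, w x := by simp; ring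
    _ ≤ 2 ^ n * ∑ i, T * ∑ x, w x * (boolSign (x i k) - μ i) ^ 2 := by
        gcongr with i
        exact sum_le_mul_sum_boolSign_sub_sq hw hT k i _ hT1
    _ = T * ∑ x, w x * (2 ^ Fintype.card (Fin n) * ∑ i, (boolSign (x i k) - μ i) ^ 2) := by
        rw [← Finset.mul_sum, Finset.sum_comm, Fintype.card_fin]
        simp_rw [← Finset.mul_sum, mul_left_comm _ ((2 : ℝ) ^ n), ← Finset.mul_sum]
        rw [mul_left_comm]
    _ = T * ∑ s : Fin n → Bool, ∑ x, w x *
          (∑ i, boolSign (s i) * boolSign (x i k) - ∑ i, boolSign (s i) * μ i) ^ 2 := by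
        rw [Finset.sum_comm]
        congr 1
        refine Finset.sum_congr rfl fun x _ => ?_
        rw [← sum_sq_sum_boolSign_mul, Finset.mul_sum]
        refine Finset.sum_congr rfl fun s _ => ?_
        simp_rw [mul_sub, Finset.sum_sub_distrib]
    _ ≤ _ := by
        refine mul_le_mul_of_nonneg_left (Finset.sum_le_sum fun s _ => ?_) (by linarith)
        rw [← hmean s]
        exact sum_mul_sq_sub_mean_le w _ hW (z s)

/-- Every private mechanism has a sign query which it answers with risk at least
`1 / (4 e^ε n)`. -/
theorem le_iSup_risk {ε a b c : ℝ} (hε : 0 < ε) (ha : a ≤ 0) (hb : 1 ≤ b) (hc1 : c ≤ 1)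
    (k : Fin l) (hn : 0 < n) {p : Db l n → Db l n → ℝ} (h0 : ∀ x y, 0 ≤ p x y)
    (h1 : ∀ x, ∑ y, p x y = 1)
    (hp : ∀ x x', Neighbor x x' → ∀ y, p x y ≤ Real.exp ε * p x' y) :
    1 / (4 * Real.exp ε * n) ≤ ⨆ φ : {φ : Fin n → Row l → ℝ // StatQ a b c φ},
      ⨅ q : {q : Db l n → ℝ // ∀ y, ∃ x0, q y = qS φ.1 x0},
        ⨆ x : Db l n, ∑ y, p x y * (q.1 y - qS φ.1 x) ^ 2 := by
  by_contra! hlt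
  set B := 1 / (4 * Real.exp ε * n) with hB
  have hn' : (0 : ℝ) < n := by exact_mod_cast hn
  have hs : ∀ s : Fin n → Bool, ∃ q : Db l n → ℝ, ∀ x,
      ∑ y, p x y * (q y - qS (signQuery k s) x) ^ 2 < B := by
    intro s
    have h2 := (le_ciSup (f := fun φ : {φ : Fin n → Row l → ℝ // StatQ a b c φ} =>
      ⨅ q : {q : Db l n → ℝ // ∀ y, ∃ x0, q y = qS φ.1 x0},
        ⨆ x : Db l n, ∑ y, p x y * (q.1 y - qS φ.1 x) ^ 2)
      ⟨1, by rintro _ ⟨φ, rfl⟩; exact iInf_iSup_le_one h0 h1 φ.1⟩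
      ⟨signQuery k s, statQ_signQuery ha hb hc1 k s⟩).trans_lt hlt
    have : Nonempty {q : Db l n → ℝ // ∀ y, ∃ x0, q y = qS (signQuery k s) x0} :=
      ⟨⟨qS _, fun y => ⟨y, rfl⟩⟩⟩
    obtain ⟨q, hq⟩ := exists_lt_of_ciInf_lt h2
    exact ⟨q.1, fun x => (le_ciSup (Set.finite_range _).bddAbove x).trans_lt hq⟩
  choose q hq using hs
  have hup : ∑ s : Fin n → Bool, ∑ x, ∑ y, p x y * (q s y - qS (signQuery k s) x) ^ 2 <
      ∑ _s : Fin n → Bool, ∑ _x : Db l n, B :=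
    Finset.sum_lt_sum_of_nonempty Finset.univ_nonempty fun s _ =>
      Finset.sum_lt_sum_of_nonempty Finset.univ_nonempty fun x _ => hq s x
  have hlow : ∀ y, 2 ^ n * n * ∑ x, p x y ≤ Real.exp ε * ∑ s : Fin n → Bool, ∑ x,
      p x y * (4 * n ^ 2 * (q s y - qS (signQuery k s) x) ^ 2) := by
    intro y
    refine (two_pow_mul_sum_le (fun x => h0 x y) (fun x x' h => hp x x' h y)
      (Real.one_le_exp hε.le) k (fun s => (2 * q s y - 1) * n)).trans_eq ?_
    congr 1
    refine Finset.sum_congr rfl fun s _ => Finset.sum_congr rfl fun x _ => ?_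
    rw [qS_signQuery hn]
    field_simp
    ring
  have hsum := Finset.sum_le_sum fun (y : Db l n) (_ : y ∈ Finset.univ) => hlow y
  have e1 : ∑ y : Db l n, 2 ^ n * n * ∑ x, p x y = 2 ^ n * n * (Fintype.card (Db l n) : ℝ) := by
    rw [← Finset.mul_sum, Finset.sum_comm]
    simp [h1]
  have e2 : ∑ y : Db l n, Real.exp ε * ∑ s : Fin n → Bool, ∑ x,
      p x y * (4 * n ^ 2 * (q s y - qS (signQuery k s) x) ^ 2) =
      Real.exp ε * (4 * n ^ 2) *
        ∑ s : Fin n → Bool, ∑ x, ∑ y, p x y * (q s y - qS (signQuery k s) x) ^ 2 := by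
    rw [← Finset.mul_sum, Finset.sum_comm, mul_assoc, Finset.mul_sum (a := 4 * (n : ℝ) ^ 2)]
    congr 1
    refine Finset.sum_congr rfl fun s _ => ?_
    rw [Finset.sum_comm]
    simp_rw [Finset.mul_sum, mul_left_comm (p _ _)]
  rw [e1, e2] at hsum
  have hup' := mul_lt_mul_of_pos_left hup (show 0 < Real.exp ε * (4 * n ^ 2) by positivity)
  refine absurd (hsum.trans_lt hup') (not_lt.2 (le_of_eq ?_))
  simp only [Finset.sum_const, Finset.card_univ, nsmul_eq_mul, Fintype.card_pi_const,
    Fintype.card_bool, hB]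
  push_cast
  field_simp

end SignQuery

section RandomizedResponse

variable {l n : ℕ}

/-- Normalizing constant of randomized response on one row. -/
noncomputable def rrNorm (l : ℕ) (u : ℝ) : ℝ := 1 + ((2 : ℝ) ^ l - 1) * u

/-- Randomized response on one row, with weight ratio `u` between changing to a given other value
and keeping the row. -/
noncomputable def rrRow (u : ℝ) (v v' : Row l) : ℝ := (if v' = v then 1 else u) / rrNorm l u

theorem rrNorm_pos {u : ℝ} (hu : 0 ≤ u) : 0 < rrNorm l u := by
  have h : (1 : ℝ) ≤ 2 ^ l := one_le_pow₀ (by norm_num)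
  have := mul_nonneg (sub_nonneg.2 h) hu
  unfold rrNorm
  linarith

theorem rrRow_nonneg {u : ℝ} (hu : 0 ≤ u) (v v' : Row l) : 0 ≤ rrRow u v v' := by
  have := rrNorm_pos (l := l) hu
  unfold rrRow
  split_ifs <;> positivity

theorem sum_rrRow_mul (u : ℝ) (v : Row l) (f : Row l → ℝ) :
    ∑ v', rrRow u v v' * f v' = (u * ∑ v', f v' + (1 - u) * f v) / rrNorm l u := by
  have e : ∀ v', rrRow u v v' * f v' =
      (u * f v' + if v' = v then (1 - u) * f v' else 0) / rrNorm l u := by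
    intro v'
    unfold rrRow
    split_ifs <;> ring
  simp_rw [e, ← Finset.sum_div, Finset.sum_add_distrib, ← Finset.mul_sum]
  simp

theorem sum_rrRow {u : ℝ} (hu : 0 ≤ u) (v : Row l) : ∑ v', rrRow u v v' = 1 := by
  have h := sum_rrRow_mul u v fun _ => 1
  simp only [mul_one] at h
  rw [h, div_eq_one_iff_eq (rrNorm_pos hu).ne']
  simp [rrNorm]
  ring

theorem rrRow_le {u : ℝ} (hu : 0 < u) (hu1 : u ≤ 1) (v v' t : Row l) :
    rrRow u v t ≤ u⁻¹ * rrRow u v' t := by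
  have hN := rrNorm_pos (l := l) hu.le
  have h1 : u ≤ u⁻¹ := hu1.trans (one_le_inv_iff₀.2 ⟨hu, hu1⟩)
  have h2 : 1 ≤ u⁻¹ := one_le_inv_iff₀.2 ⟨hu, hu1⟩
  unfold rrRow
  rw [← mul_div_assoc]
  gcongr
  split_ifs <;> simp [hu.ne', h1, h2, hu1]

/-- Randomized response on all rows independently. -/
noncomputable def rr (u : ℝ) (x y : Db l n) : ℝ := ∏ i, rrRow u (x i) (y i)

theorem rr_nonneg {u : ℝ} (hu : 0 ≤ u) (x y : Db l n) : 0 ≤ rr u x y :=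
  Finset.prod_nonneg fun _ _ => rrRow_nonneg hu _ _

theorem sum_rr {u : ℝ} (hu : 0 ≤ u) (x : Db l n) : ∑ y, rr u x y = 1 := by
  unfold rr
  rw [← Fintype.prod_sum fun i v => rrRow u (x i) v]
  simp [sum_rrRow hu]

theorem rr_le {u : ℝ} (hu : 0 < u) (hu1 : u ≤ 1) {x x' : Db l n} (h : Neighbor x x')
    (y : Db l n) : rr u x y ≤ u⁻¹ * rr u x' y := by
  obtain ⟨j, hj⟩ := Finset.card_eq_one.1 h
  have hx : ∀ i, i ≠ j → x i = x' i := by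
    intro i hi
    by_contra hne
    have : i ∈ Finset.univ.filter fun i => x i ≠ x' i := by simpa using hne
    rw [hj, Finset.mem_singleton] at this
    exact hi this
  unfold rr
  rw [← Finset.mul_prod_erase _ _ (Finset.mem_univ j),
    ← Finset.mul_prod_erase _ (fun i => rrRow u (x' i) (y i)) (Finset.mem_univ j), ← mul_assoc]
  rw [Finset.prod_congr rfl fun i hi => by rw [hx i (Finset.ne_of_mem_erase hi)]]
  exact mul_le_mul_of_nonneg_right (rrRow_le hu hu1 _ _ _)
    (Finset.prod_nonneg fun _ _ => rrRow_nonneg hu.le _ _)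

/-- Error of the unbiased estimate of `f v` from a randomized response to `v`. -/
noncomputable def rrErr (u : ℝ) (f : Row l → ℝ) (v v' : Row l) : ℝ :=
  rrNorm l u / (1 - u) * f v' - u / (1 - u) * ∑ t, f t - f v

theorem sum_rrRow_mul_rrErr {u : ℝ} (hu : 0 < u) (hu1 : u < 1) (f : Row l → ℝ) (v : Row l) :
    ∑ v', rrRow u v v' * rrErr u f v v' = 0 := by
  have hN := (rrNorm_pos (l := l) hu.le).ne'
  have h1 : 1 - u ≠ 0 := by linarith
  have e : ∀ v', rrRow u v v' * rrErr u f v v' = rrNorm l u / (1 - u) * (rrRow u v v' * f v')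
      - rrRow u v v' * (u / (1 - u) * ∑ t, f t + f v) := fun v' => by unfold rrErr; ring
  simp_rw [e, Finset.sum_sub_distrib, ← Finset.mul_sum, ← Finset.sum_mul]
  rw [sum_rrRow_mul, sum_rrRow hu.le]
  field_simp
  ring

/-- A bound for `rrErr` when the row function is bounded by `R`. -/
noncomputable def rrErrBound (l : ℕ) (u R : ℝ) : ℝ :=
  rrNorm l u / (1 - u) * R + u / (1 - u) * (2 ^ l * R) + R

theorem abs_rrErr_le {u R : ℝ} (hu : 0 < u) (hu1 : u < 1) {f : Row l → ℝ} (hf : ∀ v, |f v| ≤ R)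
    (v v' : Row l) : |rrErr u f v v'| ≤ rrErrBound l u R := by
  have hN : 0 ≤ rrNorm l u / (1 - u) := div_nonneg (rrNorm_pos hu.le).le (by linarith)
  have hU : 0 ≤ u / (1 - u) := div_nonneg hu.le (by linarith)
  have hs : |∑ t, f t| ≤ 2 ^ l * R := by
    refine (Finset.abs_sum_le_sum_abs _ _).trans
      ((Finset.sum_le_sum fun t _ => hf t).trans_eq ?_)
    simp
  unfold rrErr rrErrBound
  refine (abs_sub _ _).trans (add_le_add ((abs_sub _ _).trans (add_le_add ?_ ?_)) (hf v))
  · rw [abs_mul, abs_of_nonneg hN]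
    exact mul_le_mul_of_nonneg_left (hf v') hN
  · rw [abs_mul, abs_of_nonneg hU]
    exact mul_le_mul_of_nonneg_left hs hU

/-- Second moment of the total error of randomized response. -/
theorem sum_rr_mul_sq_le {u R : ℝ} (hu : 0 < u) (hu1 : u < 1) {φ : Fin n → Row l → ℝ}
    (hφ : ∀ i v, |φ i v| ≤ R) (x : Db l n) :
    ∑ y, rr u x y * (∑ i, rrErr u (φ i) (x i) (y i)) ^ 2 ≤ n * rrErrBound l u R ^ 2 := by
  unfold rr
  rw [sum_prod_mul_sq_sum (fun i v => rrRow u (x i) v) (fun i v => rrErr u (φ i) (x i) v)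
    (fun i => sum_rrRow hu.le _) (fun i => sum_rrRow_mul_rrErr hu hu1 _ _)]
  have : ∀ i : Fin n, ∑ v, rrRow u (x i) v * rrErr u (φ i) (x i) v ^ 2 ≤ rrErrBound l u R ^ 2 := by
    intro i
    rw [← one_mul (rrErrBound l u R ^ 2), ← sum_rrRow hu.le (x i), Finset.sum_mul]
    refine Finset.sum_le_sum fun v _ => mul_le_mul_of_nonneg_left ?_ (rrRow_nonneg hu.le _ _)
    exact sq_le_sq.2 ((abs_rrErr_le hu hu1 (hφ i) _ _).trans (le_abs_self _))
  refine (Finset.sum_le_sum fun i _ => this i).trans_eq ?_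
  simp

/-- The unbiased estimate of a statistical query from a randomized response. -/
noncomputable def rrEst (u : ℝ) (φ : Fin n → Row l → ℝ) (y : Db l n) : ℝ :=
  (∑ i, (rrNorm l u / (1 - u) * φ i (y i) - u / (1 - u) * ∑ t, φ i t)) /
    ∑ i, (Bmax φ i - Amin φ i)

theorem rrEst_sub_qS (u : ℝ) (φ : Fin n → Row l → ℝ) (x y : Db l n) :
    rrEst u φ y - qS φ x =
      (∑ i, rrErr u (φ i) (x i) (y i)) / ∑ i, (Bmax φ i - Amin φ i) := by
  unfold rrEst qS rrErr
  rw [← sub_div, ← Finset.sum_sub_distrib]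

/-- Randomized response answers every statistical query with risk `O(1 / n)`. -/
theorem iInf_iSup_rr_le {u a b c : ℝ} (hu : 0 < u) (hu1 : u < 1) (hc : 0 < c) (hn : 0 < n)
    {φ : Fin n → Row l → ℝ} (hφ : StatQ a b c φ) :
    ⨅ q : {q : Db l n → ℝ // ∀ y, ∃ x0, q y = qS φ x0},
      ⨆ x : Db l n, ∑ y, rr u x y * (q.1 y - qS φ x) ^ 2 ≤
        4 * rrErrBound l u (|a| + |b|) ^ 2 / (n * c ^ 2) := by
  have hn' : (0 : ℝ) < n := by exact_mod_cast hn
  have hR : ∀ i v, |φ i v| ≤ |a| + |b| := by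
    intro i v
    obtain ⟨h1, -, h2, -⟩ := hφ i
    rw [abs_le]
    constructor <;> linarith [Amin_le φ i v, le_Bmax φ i v, neg_abs_le a, le_abs_self b,
      abs_nonneg a, abs_nonneg b]
  have hproj : ∀ y, ∃ x0, ∀ x, |rrEst u φ y - qS φ x0| ≤ |rrEst u φ y - qS φ x| := fun y =>
    Finite.exists_min fun x => |rrEst u φ y - qS φ x|
  choose π hπ using hproj
  set S := ∑ i, (Bmax φ i - Amin φ i) with hS
  have hSn : n * c ≤ S := by
    have := Finset.sum_le_sum fun (i : Fin n) (_ : i ∈ Finset.univ) => (hφ i).2.2.2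
    simpa only [Finset.sum_const, Finset.card_univ, Fintype.card_fin, nsmul_eq_mul] using this
  have hnc : 0 < n * c := by positivity
  have hS0 : 0 < S := hnc.trans_le hSn
  refine (ciInf_le (f := fun q : {q : Db l n → ℝ // ∀ y, ∃ x0, q y = qS φ x0} =>
    ⨆ x : Db l n, ∑ y, rr u x y * (q.1 y - qS φ x) ^ 2) ⟨0, ?_⟩ ⟨fun y => qS φ (π y), fun y => ⟨π y, rfl⟩⟩).trans (ciSup_le fun x => ?_)
  · rintro _ ⟨q, rfl⟩
    exact iSup_sum_mul_sq_nonneg (rr_nonneg hu.le) φ q.1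
  calc ∑ y, rr u x y * (qS φ (π y) - qS φ x) ^ 2
      ≤ ∑ y, rr u x y * (4 * (rrEst u φ y - qS φ x) ^ 2) := by
        refine Finset.sum_le_sum fun y _ => mul_le_mul_of_nonneg_left ?_ (rr_nonneg hu.le _ _)
        have h1 := abs_sub_le (qS φ (π y)) (rrEst u φ y) (qS φ x)
        rw [abs_sub_comm (qS φ (π y)) (rrEst u φ y)] at h1
        have h2 : |qS φ (π y) - qS φ x| ≤ 2 * |rrEst u φ y - qS φ x| := by linarith [hπ y x]
        have h3 := pow_le_pow_left₀ (abs_nonneg _) h2 2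
        rw [mul_pow, sq_abs, sq_abs] at h3
        linarith
    _ = 4 / S ^ 2 * ∑ y, rr u x y * (∑ i, rrErr u (φ i) (x i) (y i)) ^ 2 := by
        rw [Finset.mul_sum]
        refine Finset.sum_congr rfl fun y _ => ?_
        rw [rrEst_sub_qS, ← hS]
        ring
    _ ≤ 4 / (n * c) ^ 2 * (n * rrErrBound l u (|a| + |b|) ^ 2) := by
        refine mul_le_mul ?_ (sum_rr_mul_sq_le hu hu1 hR x) ?_ (by positivity)
        · gcongr
        · exact Finset.sum_nonneg fun y _ => mul_nonneg (rr_nonneg hu.le _ _) (sq_nonneg _)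
    _ = _ := by field_simp

end RandomizedResponse

section Minimax

variable {l n : ℕ} {ε a b c : ℝ}

theorem rr_exp_neg_mechanism (hε : 0 < ε) :
    (∀ x y : Db l n, 0 ≤ rr (Real.exp (-ε)) x y) ∧
      (∀ x : Db l n, ∑ y, rr (Real.exp (-ε)) x y = 1) ∧
      ∀ x x' : Db l n, Neighbor x x' → ∀ y,
        rr (Real.exp (-ε)) x y ≤ Real.exp ε * rr (Real.exp (-ε)) x' y := by
  have h := Real.exp_pos (-ε)
  refine ⟨rr_nonneg h.le, sum_rr h.le, fun x x' hx y => ?_⟩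
  have := rr_le h (Real.exp_le_one_iff.2 (by linarith)) hx y
  rwa [Real.exp_neg, inv_inv, ← Real.exp_neg] at this

theorem le_minimaxS (hl : 1 ≤ l) (hε : 0 < ε) (ha : a ≤ 0) (hb : 1 ≤ b) (hc1 : c ≤ 1)
    (hn : 0 < n) : 1 / (4 * Real.exp ε * n) ≤ minimaxS l ε a b c n := by
  have : Nonempty {p : Db l n → Db l n → ℝ // (∀ x y, 0 ≤ p x y) ∧ (∀ x, ∑ y, p x y = 1) ∧
      ∀ x x', Neighbor x x' → ∀ y, p x y ≤ Real.exp ε * p x' y} :=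
    ⟨⟨_, rr_exp_neg_mechanism hε⟩⟩
  exact le_ciInf fun M => le_iSup_risk hε ha hb hc1 ⟨0, hl⟩ hn M.2.1 M.2.2.1 M.2.2.2

theorem minimaxS_le (hl : 1 ≤ l) (hε : 0 < ε) (ha : a ≤ 0) (hb : 1 ≤ b) (hc : 0 < c)
    (hc1 : c ≤ 1) (hn : 0 < n) :
    minimaxS l ε a b c n ≤
      4 * rrErrBound l (Real.exp (-ε)) (|a| + |b|) ^ 2 / (n * c ^ 2) := by
  have : Nonempty {φ : Fin n → Row l → ℝ // StatQ a b c φ} :=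
    ⟨⟨_, statQ_signQuery ha hb hc1 ⟨0, hl⟩ fun _ => true⟩⟩
  refine (ciInf_le (f := fun M : {p : Db l n → Db l n → ℝ // (∀ x y, 0 ≤ p x y) ∧
      (∀ x, ∑ y, p x y = 1) ∧ ∀ x x', Neighbor x x' → ∀ y, p x y ≤ Real.exp ε * p x' y} =>
    ⨆ φ : {φ : Fin n → Row l → ℝ // StatQ a b c φ},
      ⨅ q : {q : Db l n → ℝ // ∀ y, ∃ x0, q y = qS φ.1 x0},
        ⨆ x : Db l n, ∑ y, M.1 x y * (q.1 y - qS φ.1 x) ^ 2)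
    ⟨0, ?_⟩ ⟨_, rr_exp_neg_mechanism hε⟩).trans (ciSup_le fun φ =>
    iInf_iSup_rr_le (Real.exp_pos _) (Real.exp_lt_one_iff.2 (by linarith)) hc hn φ.2)
  rintro _ ⟨M, rfl⟩
  exact Real.iSup_nonneg fun φ => Real.iInf_nonneg fun q => iSup_sum_mul_sq_nonneg M.2.1 φ.1 q.1

theorem sq_one_sub_Φ1_le_one : (1 - Φ1) ^ 2 ≤ 1 := by
  have h0 : 0 ≤ Φ1 := ENNReal.toReal_nonneg
  have h1 : Φ1 ≤ 1 :=
    ENNReal.toReal_le_of_le_ofReal zero_le_one (by simpa using MeasureTheory.prob_le_one)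
  exact pow_le_one₀ (by linarith) (by linarith)

theorem gaussian_constant_le (hl : 1 ≤ l) :
    (1 - Φ1) ^ 2 / ((2 : ℝ) ^ (l + 4) * (1 + Real.exp ε / ((2 : ℝ) ^ l - 1)) ^ 3) ≤
      1 / (4 * Real.exp ε) := by
  have hm : (2 : ℝ) ≤ 2 ^ l := by
    simpa using pow_le_pow_right₀ (one_le_two : (1 : ℝ) ≤ 2) hl
  set m : ℝ := 2 ^ l
  set t := Real.exp ε with ht
  have ht0 : 0 < t := Real.exp_pos ε
  have hm1 : 0 < m - 1 := by linarith
  have h1 : t / m ≤ (1 + t / (m - 1)) ^ 3 := by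
    have h2 : t / m ≤ t / (m - 1) := div_le_div_of_nonneg_left ht0.le hm1 (by linarith)
    have h3 : 0 ≤ t / (m - 1) := by positivity
    have h4 := le_self_pow₀ (show 1 ≤ 1 + t / (m - 1) by linarith) (show 3 ≠ 0 by norm_num)
    linarith
  have h5 : t ≤ m * (1 + t / (m - 1)) ^ 3 := by
    rwa [div_le_iff₀' (by linarith)] at h1
  refine div_le_div₀ zero_le_one sq_one_sub_Φ1_le_one (by positivity) ?_
  rw [pow_add]
  linarith

end Minimax

/-- Asymptotic lower bound on the minimax distortion for statistical queries:
`liminf_{n→∞} n · D_{ε,n}^S ≥ (1-Φ(1))² / (2^{l+4} (1+e^ε/(2^l-1))³)`. -/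
theorem stmt9 (l : ℕ) (hl : 1 ≤ l) (ε : ℝ) (hε : 0 < ε) (a b c : ℝ)
    (ha : a ≤ 0) (hb : 1 ≤ b) (hc : 0 < c) (hc1 : c ≤ 1) :
    (1 - Φ1) ^ 2 / ((2:ℝ) ^ (l + 4) * (1 + Real.exp ε / ((2:ℝ) ^ l - 1)) ^ 3)
      ≤ Filter.atTop.liminf (fun n : ℕ => (n : ℝ) * minimaxS l ε a b c n) := by
  have hpos : ∀ᶠ n : ℕ in Filter.atTop, 0 < n := Filter.eventually_gt_atTop 0
  refine Filter.le_liminf_of_le (Filter.IsBoundedUnder.isCoboundedUnder_ge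
    (Filter.isBoundedUnder_of_eventually_le
      (a := 4 * rrErrBound l (Real.exp (-ε)) (|a| + |b|) ^ 2 / c ^ 2) ?_)) ?_
  · filter_upwards [hpos] with n hn
    have hn' : (0 : ℝ) < n := by exact_mod_cast hn
    refine (mul_le_mul_of_nonneg_left (minimaxS_le hl hε ha hb hc hc1 hn) hn'.le).trans_eq ?_
    field_simp
  · filter_upwards [hpos] with n hn
    have hn' : (0 : ℝ) < n := by exact_mod_cast hn
    refine (gaussian_constant_le hl).trans (le_trans (le_of_eq ?_)
      (mul_le_mul_of_nonneg_left (le_minimaxS hl hε ha hb hc1 hn) hn'.le))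
    field_simp
end

section
/- There exists a universal constant C such that for every integer l ≥ 1, every integer n ≥ 1, every real ε > 0, every ε-differentially private mechanism M with range D^n, and every map q̂ : D^n × D^n → ℝ (an estimator q̂(·,z) for each Hamming query q_z), one has sup over z ∈ D^n and x ∈ D^n of E_{Y∼p_M(·|x)}[(q̂(Y,z) − d(x,z)/n)²] ≥ (1/(4n²))·max{(1−Φ(1))·σ·γ^{3/2}·√n − C·ρ·γ/σ³, 0}², where γ = 1/(2(1+e^ε/(2^l−1))), σ² = 2^{1−l}, and ρ = 2^{1−l}. -/
open Finset

/-- `γ = 1/(2(1+e^ε/(2^l-1)))`. -/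
noncomputable def γc (l : ℕ) (ε : ℝ) : ℝ := 1 / (2 * (1 + Real.exp ε / ((2:ℝ) ^ l - 1)))

/-- `σ` with `σ² = 2^{1-l}`. -/
noncomputable def σc (l : ℕ) : ℝ := Real.sqrt ((2:ℝ) ^ (1 - (l : ℤ)))

/-- `ρ = 2^{1-l}`. -/
noncomputable def ρc (l : ℕ) : ℝ := (2:ℝ) ^ (1 - (l : ℤ))

/-- Resampling one coordinate of a uniformly random vector leaves sums unchanged. -/
theorem sum_sum_update {ι α : Type*} [Fintype ι] [DecidableEq ι] [Fintype α]
    (F : (ι → α) → ℝ) (i : ι) :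
    ∑ z : ι → α, ∑ b : α, F (Function.update z i b) = Fintype.card α * ∑ z, F z := by
  have hinv : Function.Involutive
      (fun t : (ι → α) × α => (Function.update t.1 i t.2, t.1 i)) := by
    rintro ⟨z, b⟩
    simp
  have h := Equiv.sum_comp (hinv.toPerm) (fun t : (ι → α) × α => F t.1)
  simp only [Function.Involutive.coe_toPerm, Fintype.sum_prod_type] at h
  rw [h]
  simp [Finset.mul_sum]

/-- Second moment of a sum of independent centred variables, for uniformly random `z`. -/
theorem card_mul_sum_sq_sum {ι α : Type*} [Fintype ι] [DecidableEq ι] [Fintype α]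
    (h : ι → α → ℝ) (h0 : ∀ i, ∑ b, h i b = 0) :
    Fintype.card α * ∑ z : ι → α, (∑ i, h i (z i)) ^ 2
      = Fintype.card (ι → α) * ∑ i, ∑ b, h i b ^ 2 := by
  have key : ∀ i j, Fintype.card α * ∑ z : ι → α, h i (z i) * h j (z j)
      = if i = j then Fintype.card (ι → α) * ∑ b, h i b ^ 2 else 0 := by
    intro i j
    rw [← sum_sum_update (fun z => h i (z i) * h j (z j)) i]
    split_ifs with hij
    · subst hij
      simp [sq]
    · simp [Function.update_of_ne (Ne.symm hij), ← Finset.sum_mul, h0]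
  calc Fintype.card α * ∑ z : ι → α, (∑ i, h i (z i)) ^ 2
      = ∑ i, ∑ j, Fintype.card α * ∑ z : ι → α, h i (z i) * h j (z j) := by
        simp only [sq, Finset.sum_mul_sum]
        rw [Finset.sum_comm, Finset.mul_sum]
        refine Finset.sum_congr rfl fun i _ => ?_
        rw [Finset.sum_comm, Finset.mul_sum]
    _ = _ := by simp [key, Finset.mul_sum]

/-- The weighted second moment dominates half the weighted mean squared difference of pairs. -/
theorem sum_sum_sq_sub_le {β : Type*} [Fintype β] (w f : β → ℝ) (q : ℝ) :
    ∑ x, ∑ x', w x * w x' * (f x - f x') ^ 2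
      ≤ 2 * ((∑ x, w x) * ∑ x, w x * (q - f x) ^ 2) := by
  have h : ∑ x, ∑ x', w x * w x' * (f x - f x') ^ 2
      = 2 * ((∑ x, w x) * ∑ x, w x * (q - f x) ^ 2) - 2 * (∑ x, w x * (q - f x)) ^ 2 := by
    have e : ∀ x x', w x * w x' * (f x - f x') ^ 2
        = w x * (w x' * (q - f x') ^ 2) + w x * (q - f x) ^ 2 * w x'
          - 2 * (w x * (q - f x) * (w x' * (q - f x'))) := fun x x' => by ring
    simp only [e, Finset.sum_add_distrib, Finset.sum_sub_distrib, ← Finset.mul_sum,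
      ← Finset.sum_mul]
    ring
  rw [h]
  nlinarith [sq_nonneg (∑ x, w x * (q - f x))]

theorem ham_eq_sum {l n : ℕ} (x y : Db l n) :
    (ham x y : ℝ) = ∑ i, if x i = y i then 0 else 1 := by
  simp [ham, Finset.card_filter, ite_not]

theorem sum_ham_sub_sq {l n : ℕ} (x x' : Db l n) :
    (2 : ℝ) ^ l * ∑ z, ((ham x z : ℝ) - ham x' z) ^ 2
      = Fintype.card (Db l n) * (2 * ham x x') := by
  have h := card_mul_sum_sq_sum
    (fun i (b : Row l) => (if x i = b then (0 : ℝ) else 1) - if x' i = b then 0 else 1)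
    (fun i => by simp [Finset.sum_ite, Finset.filter_ne, Finset.filter_eq])
  have hc : (Fintype.card (Row l) : ℝ) = 2 ^ l := by simp
  rw [hc] at h
  simp only [ham_eq_sum, ← Finset.sum_sub_distrib]
  rw [h, Finset.mul_sum _ _ (2 : ℝ)]
  congr 1
  refine Finset.sum_congr rfl fun i _ => ?_
  by_cases hx : x i = x' i
  · simp [hx]
  · have e : ∀ b, ((if x i = b then (0 : ℝ) else 1) - if x' i = b then 0 else 1) ^ 2
        = (if x i = b then 1 else 0) + if x' i = b then 1 else 0 := by
      intro b
      by_cases h1 : x i = b <;> by_cases h2 : x' i = b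
      · exact absurd (h1.trans h2.symm) hx
      all_goals simp [h1, h2]
    simp only [e, Finset.sum_add_distrib]
    simp [hx]
    norm_num

theorem neighbor_update {l n : ℕ} (x : Db l n) (i : Fin n) {a b : Row l} (hab : a ≠ b) :
    Neighbor (Function.update x i a) (Function.update x i b) := by
  unfold Neighbor
  rw [Finset.card_eq_one]
  refine ⟨i, ?_⟩
  ext j
  by_cases hj : j = i
  · subst hj
    simp [hab]
  · simp [hj]

theorem one_lt_two_pow_real {l : ℕ} (hl : 1 ≤ l) : (1 : ℝ) < 2 ^ l :=
  one_lt_pow₀ (by norm_num) (by omega)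

theorem γc_pos {l : ℕ} (hl : 1 ≤ l) (ε : ℝ) : 0 < γc l ε := by
  have := one_lt_two_pow_real hl
  have : (0 : ℝ) < 2 ^ l - 1 := by linarith
  unfold γc
  positivity

theorem γc_le_half {l : ℕ} (hl : 1 ≤ l) (ε : ℝ) : γc l ε ≤ 1 / 2 := by
  have := one_lt_two_pow_real hl
  have h : 0 ≤ Real.exp ε / ((2 : ℝ) ^ l - 1) :=
    div_nonneg (Real.exp_pos ε).le (by linarith)
  unfold γc
  exact one_div_le_one_div_of_le (by norm_num) (by linarith)

/-- Under a weight with `e^ε`-bounded ratios on neighbors, each row differs from any given value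
with conditional probability at least `2γ`. -/
theorem two_γc_mul_sum_le {l n : ℕ} (hl : 1 ≤ l) {ε : ℝ} {w : Db l n → ℝ}
    (hw : ∀ x x', Neighbor x x' → w x ≤ Real.exp ε * w x') (i : Fin n) (a : Row l) :
    2 * γc l ε * ∑ x, w x ≤ ∑ x, w x * if x i = a then 0 else 1 := by
  have hm := one_lt_two_pow_real hl
  have hm' : (0 : ℝ) < 2 ^ l - 1 := by linarith
  have hc : (0 : ℝ) < Fintype.card (Row l) := by exact_mod_cast Fintype.card_pos
  refine le_of_mul_le_mul_left ?_ hc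
  rw [mul_left_comm, ← sum_sum_update w i, ← sum_sum_update _ i, Finset.mul_sum]
  refine Finset.sum_le_sum fun x _ => ?_
  simp only [Function.update_self]
  set A := w (Function.update x i a)
  set B := ∑ b, w (Function.update x i b) * if b = a then (0 : ℝ) else 1
  have hsplit : ∑ b, w (Function.update x i b) = A + B := by
    have : A = ∑ b, w (Function.update x i b) * if b = a then (1 : ℝ) else 0 := by simp [A]
    rw [this, ← Finset.sum_add_distrib]
    refine Finset.sum_congr rfl fun b _ => ?_
    split_ifs <;> simp
  have hAB : ((2 : ℝ) ^ l - 1) * A ≤ Real.exp ε * B := by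
    have h1 : ((2 : ℝ) ^ l - 1) * A = ∑ b : Row l, A * if b = a then (0 : ℝ) else 1 := by
      have : ∀ b : Row l, (if b = a then (0 : ℝ) else 1) = 1 - if b = a then 1 else 0 := by
        intro b
        split_ifs <;> simp
      simp only [this, ← Finset.mul_sum, Finset.sum_sub_distrib]
      simp [mul_comm]
    rw [h1, Finset.mul_sum]
    refine Finset.sum_le_sum fun b _ => ?_
    split_ifs with hb
    · simp
    · simpa using hw _ _ (neighbor_update x i (Ne.symm hb))
  have hγ : 2 * γc l ε = (2 ^ l - 1) / (2 ^ l - 1 + Real.exp ε) := by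
    have := Real.exp_pos ε
    unfold γc
    field_simp
  have hpos : 0 < (2 : ℝ) ^ l - 1 + Real.exp ε := by positivity
  rw [hsplit, hγ, div_mul_eq_mul_div, div_le_iff₀ hpos]
  linarith

theorem σc_sq (l : ℕ) : σc l ^ 2 = 2 / 2 ^ l := by
  unfold σc
  rw [Real.sq_sqrt (by positivity), zpow_sub₀ (by norm_num)]
  simp

/-- Bayes risk, under uniform `x` and `z`, restricted to a single output of the mechanism. -/
theorem bayes_risk_le {l n : ℕ} (hl : 1 ≤ l) (hn : 1 ≤ n) {ε : ℝ} {w : Db l n → ℝ}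
    (h0 : ∀ x, 0 ≤ w x) (hw : ∀ x x', Neighbor x x' → w x ≤ Real.exp ε * w x')
    (q : Db l n → ℝ) :
    Fintype.card (Db l n) * (σc l ^ 2 * γc l ε / n) * ∑ x, w x
      ≤ ∑ z, ∑ x, w x * (q z - (ham x z : ℝ) / n) ^ 2 := by
  have hn' : (0 : ℝ) < n := by exact_mod_cast hn
  set W := ∑ x, w x with hW
  set N : ℝ := ((Fintype.card (Db l n) : ℕ) : ℝ) with hN
  set R := ∑ z, ∑ x, w x * (q z - (ham x z : ℝ) / n) ^ 2 with hR
  have hR0 : 0 ≤ R := Finset.sum_nonneg fun z _ => Finset.sum_nonneg fun x _ =>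
    mul_nonneg (h0 x) (sq_nonneg _)
  have hW0 : 0 ≤ W := Finset.sum_nonneg fun x _ => h0 x
  rcases hW0.eq_or_lt with hz | hWpos
  · rw [← hz, mul_zero]
    exact hR0
  have hpair : ∑ z, ∑ x, ∑ x', w x * w x' * ((ham x z : ℝ) / n - ham x' z / n) ^ 2
      ≤ 2 * (W * R) := by
    rw [hR, Finset.mul_sum, Finset.mul_sum]
    exact Finset.sum_le_sum fun z _ => sum_sum_sq_sub_le w (fun x => (ham x z : ℝ) / n) (q z)
  have hsum : ∑ z, ∑ x, ∑ x', w x * w x' * ((ham x z : ℝ) / n - ham x' z / n) ^ 2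
      = N * σc l ^ 2 / n ^ 2 * ∑ x, ∑ x', w x * w x' * ham x' x := by
    rw [Finset.sum_comm, Finset.mul_sum]
    refine Finset.sum_congr rfl fun x _ => ?_
    rw [Finset.sum_comm, Finset.mul_sum]
    refine Finset.sum_congr rfl fun x' _ => ?_
    have e : ∀ z, w x * w x' * ((ham x z : ℝ) / n - ham x' z / n) ^ 2
        = w x * w x' / n ^ 2 * ((ham x' z : ℝ) - ham x z) ^ 2 := fun z => by
      field_simp
      ring
    have h := sum_ham_sub_sq x' x
    simp only [e, ← Finset.mul_sum]
    rw [σc_sq, hN, ← mul_right_inj' (show (2 : ℝ) ^ l ≠ 0 by positivity), mul_left_comm, h]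
    field_simp
  have hdist : 2 * γc l ε * n * W ^ 2 ≤ ∑ x, ∑ x', w x * w x' * ham x' x := by
    have hx : ∀ x, w x * (n * (2 * γc l ε * W)) ≤ ∑ x', w x * w x' * ham x' x := by
      intro x
      simp only [mul_assoc (w x), ← Finset.mul_sum]
      refine mul_le_mul_of_nonneg_left ?_ (h0 x)
      simp only [ham_eq_sum, Finset.mul_sum]
      rw [Finset.sum_comm]
      calc (n : ℝ) * (2 * γc l ε * W) = ∑ _i : Fin n, 2 * γc l ε * W := by simp
        _ ≤ _ := Finset.sum_le_sum fun i _ => two_γc_mul_sum_le hl hw i (x i)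
    calc 2 * γc l ε * n * W ^ 2 = ∑ x, w x * (n * (2 * γc l ε * W)) := by
          rw [← Finset.sum_mul]
          ring
      _ ≤ _ := Finset.sum_le_sum fun x _ => hx x
  have hN0 : 0 ≤ N * σc l ^ 2 / n ^ 2 := by positivity
  have := (mul_le_mul_of_nonneg_left hdist hN0).trans (hsum ▸ hpair)
  refine le_of_mul_le_mul_left ?_ hWpos
  have e : N * σc l ^ 2 / n ^ 2 * (2 * γc l ε * n * W ^ 2)
      = 2 * (W * (N * (σc l ^ 2 * γc l ε / n) * W)) := by
    field_simp
  linarith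

theorem Φ1_mem_Icc : Φ1 ∈ Set.Icc (0 : ℝ) 1 :=
  ⟨ENNReal.toReal_nonneg, MeasureTheory.measureReal_le_one⟩

/-- Lower bound on the worst-case squared error of any estimator for the Hamming queries
`q_z(x) = d(x,z)/n` under any `ε`-differentially private mechanism. -/
theorem stmt10 :
    ∃ C : ℝ, ∀ (l n : ℕ), 1 ≤ l → 1 ≤ n → ∀ ε : ℝ, 0 < ε →
    ∀ p : Db l n → Db l n → ℝ,
      (∀ x y, 0 ≤ p x y) → (∀ x, ∑ y, p x y = 1) →
      (∀ x x', Neighbor x x' → ∀ y, p x y ≤ Real.exp ε * p x' y) →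
    ∀ qhat : Db l n → Db l n → ℝ,
      (1 / (4 * (n : ℝ) ^ 2)) *
          (max ((1 - Φ1) * σc l * γc l ε ^ ((3:ℝ)/2) * Real.sqrt n
                - C * ρc l * γc l ε / (σc l) ^ 3) 0) ^ 2
        ≤ ⨆ z : Db l n, ⨆ x : Db l n,
            ∑ y, p x y * (qhat y z - (ham x z : ℝ) / n) ^ 2 := by
  refine ⟨0, fun l n hl hn ε _ p hp hp1 hdp qhat => ?_⟩
  have hn' : (0 : ℝ) < n := by exact_mod_cast hn
  set r : Db l n → Db l n → ℝ := fun z x => ∑ y, p x y * (qhat y z - (ham x z : ℝ) / n) ^ 2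
  set S := ⨆ z, ⨆ x, r z x
  have hS : ∀ z x, r z x ≤ S := fun z x =>
    (le_ciSup (Set.finite_range _).bddAbove x).trans
      (le_ciSup (f := fun z => ⨆ x, r z x) (Set.finite_range _).bddAbove z)
  set N : ℝ := ((Fintype.card (Db l n) : ℕ) : ℝ) with hN
  have hNpos : 0 < N := by
    rw [hN]
    exact_mod_cast Fintype.card_pos
  have hrisk : σc l ^ 2 * γc l ε / n ≤ S := by
    have h1 : ∑ z, ∑ x, r z x ≤ N * (N * S) := by
      calc ∑ z, ∑ x, r z x ≤ ∑ _z : Db l n, ∑ _x : Db l n, S :=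
            Finset.sum_le_sum fun z _ => Finset.sum_le_sum fun x _ => hS z x
        _ = N * (N * S) := by
            simp only [Finset.sum_const, Finset.card_univ, nsmul_eq_mul, hN]
    have h2 : N * (σc l ^ 2 * γc l ε / n) * N ≤ ∑ z, ∑ x, r z x := by
      have e : ∑ z, ∑ x, r z x
          = ∑ y, ∑ z, ∑ x, p x y * (qhat y z - (ham x z : ℝ) / n) ^ 2 :=
        (Finset.sum_congr rfl fun z _ => Finset.sum_comm).trans Finset.sum_comm
      have eN : N = ∑ y, ∑ x, p x y := by
        rw [Finset.sum_comm]
        simp [hp1, hN]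
      rw [e]
      nth_rewrite 2 [eN]
      rw [Finset.mul_sum]
      exact Finset.sum_le_sum fun y _ => bayes_risk_le hl hn (fun x => hp x y)
        (fun x x' hxx => hdp x x' hxx y) (qhat y)
    refine le_of_mul_le_mul_left ?_ (mul_pos hNpos hNpos)
    linarith
  refine le_trans ?_ hrisk
  have hγ0 := γc_pos hl ε
  have hγ1 := γc_le_half hl ε
  have hσ0 : 0 ≤ σc l := Real.sqrt_nonneg _
  obtain ⟨hΦ0, hΦ1⟩ := Φ1_mem_Icc
  have hb : 0 ≤ (1 - Φ1) * σc l * γc l ε ^ ((3:ℝ)/2) * Real.sqrt n := by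
    have : 0 ≤ 1 - Φ1 := by linarith
    positivity
  have hγ3 : (γc l ε ^ ((3:ℝ)/2)) ^ 2 = γc l ε ^ 3 := by
    rw [← Real.rpow_natCast, ← Real.rpow_mul hγ0.le, ← Real.rpow_natCast]
    norm_num
  rw [zero_mul, zero_mul, zero_div, sub_zero, max_eq_left hb]
  rw [mul_pow, mul_pow, mul_pow, hγ3, Real.sq_sqrt hn'.le]
  have e : 1 / (4 * (n : ℝ) ^ 2) * ((1 - Φ1) ^ 2 * σc l ^ 2 * γc l ε ^ 3 * n)
      = (1 - Φ1) ^ 2 * (γc l ε ^ 2 / 4) * (σc l ^ 2 * γc l ε / n) := by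
    field_simp
  rw [e]
  refine mul_le_of_le_one_left (by positivity) (mul_le_one₀ ?_ (by positivity) ?_)
  · exact pow_le_one₀ (by linarith) (by linarith)
  · nlinarith
end

section
/- Let X, Y, Z, X̃ be D^n-valued random variables on a common finite probability space such that Z is independent of the triple (X, Y, X̃), X̃ and X are conditionally independent given Y, and the conditional distribution of X̃ given Y equals the conditional distribution of X given Y. Then 2·E[|E[d(X,Z)|Y,Z] − d(X,Z)|] ≥ E[|d(X,Z) − d(X̃,Z)|]. -/
open Finset

/-- Marginal pmf of `(X, Y, X̃)` from the joint pmf `p` of `(X, Y, Z, X̃)`. -/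
noncomputable def margXYT {l n : ℕ} (p : Db l n → Db l n → Db l n → Db l n → ℝ)
    (x y t : Db l n) : ℝ :=
  ∑ z, p x y z t

/-- The conditional expectation `E[d(X,Z) | Y = y, Z = z]` computed from the joint pmf `p`
of `(X, Y, Z, X̃)`. -/
noncomputable def condExp4 {l n : ℕ} (p : Db l n → Db l n → Db l n → Db l n → ℝ)
    (y z : Db l n) : ℝ :=
  (∑ x, ∑ t, (ham x z : ℝ) * p x y z t) / (∑ x, ∑ t, p x y z t)

/-- If a nonnegative weight `q` on pairs has equal marginals, the mean of `|f a - f b|` is at most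
twice the mean of `|c - f a|`, for every centre `c`. -/
theorem sum_mul_abs_sub_le_two_mul {α : Type*} [Fintype α] (q : α → α → ℝ)
    (hq : ∀ a b, 0 ≤ q a b) (hmarg : ∀ v, ∑ a, q a v = ∑ b, q v b) (f : α → ℝ) (c : ℝ) :
    ∑ a, ∑ b, q a b * |f a - f b| ≤ 2 * ∑ a, ∑ b, q a b * |c - f a| := by
  have swap : ∑ a, ∑ b, q a b * |c - f b| = ∑ a, ∑ b, q a b * |c - f a| := by
    rw [Finset.sum_comm]
    simp only [← Finset.sum_mul, hmarg]
  calc ∑ a, ∑ b, q a b * |f a - f b|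
      ≤ ∑ a, ∑ b, (q a b * |c - f a| + q a b * |c - f b|) := by
        refine Finset.sum_le_sum fun a _ => Finset.sum_le_sum fun b _ => ?_
        rw [← mul_add]
        refine mul_le_mul_of_nonneg_left ?_ (hq a b)
        rw [abs_sub_comm c (f a)]
        exact abs_sub_le (f a) c (f b)
    _ = 2 * ∑ a, ∑ b, q a b * |c - f a| := by
        simp only [Finset.sum_add_distrib]
        rw [swap, two_mul]

/-- Moves the outermost of three sums inside the other two. -/
theorem sum_comm_three {α β γ : Type*} [Fintype α] [Fintype β] [Fintype γ] (F : α → β → γ → ℝ) :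
    ∑ a, ∑ b, ∑ c, F a b c = ∑ b, ∑ c, ∑ a, F a b c := by
  rw [Finset.sum_comm]
  exact Finset.sum_congr rfl fun b _ => Finset.sum_comm

/-- If `Z` is independent of `(X, Y, X̃)`, `X̃ ⊥ X` given `Y`, and the conditional law of `X̃`
given `Y` equals that of `X` given `Y`, then
`2 E[|E[d(X,Z)|Y,Z] - d(X,Z)|] ≥ E[|d(X,Z) - d(X̃,Z)|]`.
The joint law of `(X, Y, Z, X̃)` is described by the pmf `p`. -/
theorem stmt13 (l n : ℕ) (hl : 1 ≤ l) (hn : 1 ≤ n)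
    (p : Db l n → Db l n → Db l n → Db l n → ℝ)
    (hpos : ∀ x y z t, 0 ≤ p x y z t)
    (hsum : ∑ x, ∑ y, ∑ z, ∑ t, p x y z t = 1)
    -- `Z` is independent of the triple `(X, Y, X̃)`
    (hindZ : ∀ x y z t,
      p x y z t = margXYT p x y t * (∑ x', ∑ y', ∑ t', p x' y' z t'))
    -- `X̃` and `X` are conditionally independent given `Y`
    (hci : ∀ x y t,
      margXYT p x y t * (∑ x', ∑ t', margXYT p x' y t')
        = (∑ t', margXYT p x y t') * (∑ x', margXYT p x' y t))
    -- the conditional law of `X̃` given `Y` equals the conditional law of `X` given `Y`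
    (hsame : ∀ y v, (∑ x, margXYT p x y v) = (∑ t, margXYT p v y t)) :
    (∑ x, ∑ y, ∑ z, ∑ t, p x y z t * |(ham x z : ℝ) - (ham t z : ℝ)|)
      ≤ 2 * ∑ x, ∑ y, ∑ z, ∑ t, p x y z t * |condExp4 p y z - (ham x z : ℝ)| := by
  have hmarg : ∀ y z v, ∑ x, p x y z v = ∑ t, p v y z t := by
    intro y z v
    rw [Finset.sum_congr rfl fun x _ => hindZ x y z v,
      Finset.sum_congr rfl fun t _ => hindZ v y z t, ← Finset.sum_mul, ← Finset.sum_mul, hsame]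
  rw [sum_comm_three fun x y z => ∑ t, p x y z t * |(ham x z : ℝ) - (ham t z : ℝ)|,
    sum_comm_three fun x y z => ∑ t, p x y z t * |condExp4 p y z - (ham x z : ℝ)|,
    Finset.mul_sum]
  refine Finset.sum_le_sum fun y _ => ?_
  rw [Finset.mul_sum]
  exact Finset.sum_le_sum fun z _ => sum_mul_abs_sub_le_two_mul (fun x t => p x y z t)
    (fun x t => hpos x y z t) (hmarg y z) (fun x => (ham x z : ℝ)) (condExp4 p y z)
end

section
/- There exists a universal constant C such that for every integer l ≥ 1, every integer n ≥ 1, every real γ ∈ (0,1], and every pair x, x̃ ∈ D^n with d(x,x̃) ≥ γ·n, if Z is uniformly distributed on D^n then E[|d(x,Z) − d(x̃,Z)|] ≥ (1−Φ(1))·σ·√(γ·n) − C·ρ/σ³, where σ² = 2^{1−l} and ρ = 2^{1−l}. -/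
open Finset

open scoped BigOperators in
theorem expect_fin_succ_pi {α : Type*} [Fintype α] {n : ℕ} (g : (Fin (n + 1) → α) → ℝ) :
    𝔼 z, g z = 𝔼 a, 𝔼 z : Fin n → α, g (Fin.cons a z) := by
  rw [← Finset.expect_product', Finset.univ_product_univ]
  exact (Fintype.expect_equiv (Fin.consEquiv fun _ : Fin (n + 1) => α) _ _ fun _ => rfl).symm

open scoped BigOperators in
/-- Second moment of a sum of independent centred variables. -/
theorem expect_sum_sq {α : Type*} [Fintype α] [Nonempty α] {n : ℕ} (f : Fin n → α → ℝ)
    (hf : ∀ i, 𝔼 a, f i a = 0) :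
    𝔼 z : Fin n → α, (∑ i, f i (z i)) ^ 2 = ∑ i, 𝔼 a, f i a ^ 2 := by
  induction n with
  | zero => simp
  | succ n ih =>
    have key : ∀ a (z : Fin n → α),
        (∑ i, f i ((Fin.cons a z : Fin (n + 1) → α) i)) ^ 2 =
          f 0 a ^ 2 + f 0 a * (2 * ∑ i, f i.succ (z i)) + (∑ i, f i.succ (z i)) ^ 2 := by
      intro a z
      simp only [Fin.sum_univ_succ, Fin.cons_zero, Fin.cons_succ]
      ring
    rw [expect_fin_succ_pi]
    simp only [key, Finset.expect_add_distrib, ← Finset.mul_expect, ← Finset.expect_mul,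
      Fintype.expect_const, hf, ih (fun i => f i.succ) fun i => hf i.succ]
    rw [Fin.sum_univ_succ]
    ring

open scoped BigOperators in
/-- Fourth moment bound for a sum of independent centred variables with values in `{-1, 0, 1}`. -/
theorem expect_sum_pow_four_le {α : Type*} [Fintype α] [Nonempty α] {n : ℕ}
    (f : Fin n → α → ℝ) (hf : ∀ i, 𝔼 a, f i a = 0) (hf3 : ∀ i a, f i a ^ 3 = f i a) :
    𝔼 z : Fin n → α, (∑ i, f i (z i)) ^ 4 ≤
      (∑ i, 𝔼 a, f i a ^ 2) + 3 * (∑ i, 𝔼 a, f i a ^ 2) ^ 2 := by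
  induction n with
  | zero => simp
  | succ n ih =>
    have key : ∀ a (z : Fin n → α),
        (∑ i, f i ((Fin.cons a z : Fin (n + 1) → α) i)) ^ 4 =
          f 0 a ^ 2 + f 0 a * (4 * ∑ i, f i.succ (z i)) +
            f 0 a ^ 2 * (6 * (∑ i, f i.succ (z i)) ^ 2) +
            f 0 a * (4 * (∑ i, f i.succ (z i)) ^ 3) + (∑ i, f i.succ (z i)) ^ 4 := by
      intro a z
      simp only [Fin.sum_univ_succ, Fin.cons_zero, Fin.cons_succ]
      linear_combination (f 0 a + 4 * ∑ i, f i.succ (z i)) * hf3 0 a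
    have ih' := ih (fun i => f i.succ) (fun i => hf i.succ) fun i => hf3 i.succ
    rw [expect_fin_succ_pi]
    simp only [key, Finset.expect_add_distrib, ← Finset.mul_expect, ← Finset.expect_mul,
      Fintype.expect_const, hf, expect_sum_sq (fun i => f i.succ) fun i => hf i.succ]
    rw [Fin.sum_univ_succ]
    nlinarith [sq_nonneg (𝔼 a, f 0 a ^ 2)]

open scoped BigOperators in
/-- First moment lower bound from the second and fourth moments. -/
theorem half_sqrt_le_expect_abs {β : Type*} [Fintype β] (S : β → ℝ) {v : ℝ} (hv : 1 ≤ v)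
    (h2 : 𝔼 z, S z ^ 2 = v) (h4 : 𝔼 z, S z ^ 4 ≤ v + 3 * v ^ 2) :
    √v / 2 ≤ 𝔼 z, |S z| := by
  have hs : 0 < √v := Real.sqrt_pos.2 (by linarith)
  have hvs : √v ^ 2 = v := Real.sq_sqrt (by linarith)
  have pointwise : ∀ z, 12 * v * S z ^ 2 - S z ^ 4 ≤ 16 * √v ^ 3 * |S z| := by
    intro z
    rw [← sq_abs, ← Even.pow_abs (by decide : Even 4), ← hvs]
    have ha := abs_nonneg (S z)
    have : 0 ≤ |S z| * ((|S z| - 2 * √v) ^ 2 * (|S z| + 4 * √v)) := by positivity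
    rw [Real.sqrt_sq hs.le]
    linarith [this]
  have h := Finset.expect_le_expect (s := Finset.univ) fun z _ => pointwise z
  rw [Finset.expect_sub_distrib, ← Finset.mul_expect, ← Finset.mul_expect, h2] at h
  have hv3 : √v ^ 3 = v * √v := by rw [← hvs, Real.sqrt_sq hs.le]; ring
  rw [hv3] at h
  have h8 : 8 * v * √v ^ 2 ≤ 16 * (v * √v) * 𝔼 z, |S z| := by rw [hvs]; nlinarith
  have : (v * √v) * (√v / 2) ≤ (v * √v) * 𝔼 z, |S z| := by linarith
  exact le_of_mul_le_mul_left this (by positivity)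

theorem Φ1_le_one : Φ1 ≤ 1 := MeasureTheory.measureReal_le_one

theorem half_le_Φ1 : 1 / 2 ≤ Φ1 := by
  set μ := ProbabilityTheory.gaussianReal 0 1 with hμ
  have hneg : μ.real (Set.Ici (-1)) = μ.real (Set.Iic 1) := by
    have h : μ.map (fun x => -x) = μ := by
      rw [hμ, ProbabilityTheory.gaussianReal_map_neg, neg_zero]
    conv_rhs => rw [← h]
    rw [MeasureTheory.map_measureReal_apply measurable_neg measurableSet_Iic]
    congr 1
    ext x
    simp [neg_le]
  have hunion : Set.Iic (1 : ℝ) ∪ Set.Ici (-1) = Set.univ := by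
    ext x
    simp only [Set.mem_union, Set.mem_Iic, Set.mem_Ici, Set.mem_univ, iff_true]
    by_contra! h
    linarith
  have h := MeasureTheory.measureReal_union_le (μ := μ) (Set.Iic 1) (Set.Ici (-1))
  rw [hunion, hneg, MeasureTheory.probReal_univ] at h
  change 1 / 2 ≤ μ.real (Set.Iic 1)
  linarith

/-- The contribution of a row with values `u`, `v` and sampled value `a` to the difference
of Hamming distances. -/
noncomputable def rowDiff {l : ℕ} (u v a : Row l) : ℝ :=
  (if u = a then 0 else 1) - (if v = a then 0 else 1)

theorem ham_sub_ham {l n : ℕ} (x y z : Db l n) :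
    (ham x z : ℝ) - ham y z = ∑ i, rowDiff (x i) (y i) (z i) := by
  simp only [ham_eq_sum, rowDiff, Finset.sum_sub_distrib]

theorem rowDiff_pow_three {l : ℕ} (u v a : Row l) : rowDiff u v a ^ 3 = rowDiff u v a := by
  unfold rowDiff
  split_ifs <;> norm_num

theorem rowDiff_eq {l : ℕ} (u v a : Row l) :
    rowDiff u v a = (if v = a then 1 else 0) - (if u = a then 1 else 0) := by
  unfold rowDiff
  split_ifs <;> norm_num

open scoped BigOperators in
theorem expect_rowDiff {l : ℕ} (u v : Row l) : 𝔼 a, rowDiff u v a = 0 := by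
  simp [rowDiff_eq, Finset.expect_sub_distrib]

open scoped BigOperators in
theorem expect_rowDiff_sq {l : ℕ} (u v : Row l) :
    𝔼 a, rowDiff u v a ^ 2 = ρc l * if u = v then 0 else 1 := by
  by_cases h : u = v
  · simp [rowDiff, h]
  · have key : ∀ a, rowDiff u v a ^ 2 = (if v = a then 1 else 0) + (if u = a then 1 else 0) := by
      intro a
      rw [rowDiff_eq]
      split_ifs with h1 h2
      · exact absurd (h2.trans h1.symm) h
      all_goals norm_num
    rw [Fintype.expect_eq_sum_div_card]
    simp only [key, Finset.sum_add_distrib, Finset.sum_ite_eq, Finset.mem_univ, if_true, h,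
      if_false, ρc]
    rw [zpow_sub₀ two_ne_zero]
    simp
    norm_num

/-- Berry–Esseen-based lower bound: there is a universal constant `C` such that for all
`x, x̃` with `d(x,x̃) ≥ γ n`, if `Z` is uniform on `D^n` then
`E[|d(x,Z) - d(x̃,Z)|] ≥ (1-Φ(1)) σ √(γ n) - C ρ/σ³`. -/
theorem stmt15 :
    ∃ C : ℝ, ∀ (l n : ℕ), 1 ≤ l → 1 ≤ n → ∀ γ : ℝ, 0 < γ → γ ≤ 1 →
    ∀ x xt : Db l n, γ * (n : ℝ) ≤ (ham x xt : ℝ) →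
      (1 - Φ1) * σc l * Real.sqrt (γ * (n : ℝ)) - C * ρc l / (σc l) ^ 3
        ≤ (∑ z : Db l n, |((ham x z : ℝ)) - ((ham xt z : ℝ))|) / (2:ℝ) ^ (l * n) := by
  refine ⟨1, fun l n hl _ γ hγ _ x xt hx => ?_⟩
  have hρ0 : 0 < ρc l := zpow_pos two_pos _
  have hρ1 : ρc l ≤ 1 := zpow_le_one_of_nonpos₀ one_le_two (by omega)
  have hσ0 : 0 < σc l := Real.sqrt_pos.2 hρ0
  have hσ1 : σc l ≤ 1 := Real.sqrt_le_one.2 hρ1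
  have hσsq : σc l ^ 2 = ρc l := Real.sq_sqrt hρ0.le
  have herr : 1 * ρc l / σc l ^ 3 = 1 / σc l := by
    rw [← hσsq]
    field_simp
  have hexp : (∑ z : Db l n, |(ham x z : ℝ) - (ham xt z : ℝ)|) / (2 : ℝ) ^ (l * n) =
      Finset.expect Finset.univ fun z : Db l n => |∑ i, rowDiff (x i) (xt i) (z i)| := by
    rw [Fintype.expect_eq_sum_div_card]
    simp only [ham_sub_ham]
    simp [pow_mul]
  have hvar : ∑ i, Finset.expect Finset.univ (fun a => rowDiff (x i) (xt i) a ^ 2) =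
      ρc l * ham x xt := by
    simp only [expect_rowDiff_sq, ham_eq_sum, Finset.mul_sum]
  have hinv : 1 ≤ 1 / σc l := (one_le_div hσ0).2 hσ1
  rw [herr, hexp]
  have hmain : (1 - Φ1) * σc l * √(γ * n) ≤ (1 - Φ1) * √(ρc l * ham x xt) := by
    rw [Real.sqrt_mul hρ0.le, mul_assoc]
    exact mul_le_mul_of_nonneg_left
      (mul_le_mul_of_nonneg_left (Real.sqrt_le_sqrt hx) hσ0.le) (by linarith [Φ1_le_one])
  rcases le_total 1 (ρc l * ham x xt) with hv | hv
  · have h := half_sqrt_le_expect_abs (fun z : Db l n => ∑ i, rowDiff (x i) (xt i) (z i)) hv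
      ((expect_sum_sq _ fun i => expect_rowDiff _ _).trans hvar)
      ((expect_sum_pow_four_le _ (fun i => expect_rowDiff _ _)
        fun i => rowDiff_pow_three _ _).trans_eq (by rw [hvar]))
    nlinarith [half_le_Φ1, Real.sqrt_nonneg (ρc l * ham x xt)]
  · have h : 0 ≤ Finset.expect Finset.univ
        fun z : Db l n => |∑ i, rowDiff (x i) (xt i) (z i)| :=
      Finset.expect_nonneg fun z _ => abs_nonneg _
    have := Real.sqrt_le_one.2 hv
    nlinarith [half_le_Φ1, Φ1_le_one, Real.sqrt_nonneg (ρc l * ham x xt)]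
end
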